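/- arXiv:2202.12617 — 2 statements merged into one kernel-verified Lean document; each statement's English description precedes it below -/
import Mathlib

section
/- Let p ∈ ℚ with 0 < p < 1 and p ≠ 1/2. Then h₂(p) = −p·log₂ p − (1−p)·log₂(1−p) is a transcendental real number. -/
noncomputable def binH (t : ℝ) : ℝ := -(t * Real.logb 2 t) - (1 - t) * Real.logb 2 (1 - t)

open Polynomial in
/-- The operator `P ↦ derivative P + w P`, which describes the differentiation of `P e^{wx}`. -/
noncomputable def expDeriv (w : ℝ) : ℝ[X] →ₗ[ℝ] ℝ[X] :=
  Polynomial.derivative + w • LinearMap.id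

open Polynomial in
lemma expDeriv_apply (w : ℝ) (P : ℝ[X]) : expDeriv w P = derivative P + w • P := rfl

open Polynomial in
lemma expDeriv_injective {w : ℝ} (hw : w ≠ 0) : Function.Injective (expDeriv w) := by
  rw [injective_iff_map_eq_zero]
  intro P hP
  by_contra h0
  have h1 : derivative P = -(w • P) := eq_neg_of_add_eq_zero_left hP
  have h2 := degree_derivative_lt h0
  rw [h1, degree_neg, degree_smul_of_smul_regular _ (IsSMulRegular.of_ne_zero hw)] at h2
  exact lt_irrefl _ h2

open Polynomial in
lemma degree_expDeriv_lt {D : ℕ} (w : ℝ) {P : ℝ[X]} (hP : P.degree < D) :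
    (expDeriv w P).degree < D := by
  rw [← mem_degreeLT] at *
  rw [expDeriv_apply]
  refine Submodule.add_mem _ ?_ (Submodule.smul_mem _ _ hP)
  rw [mem_degreeLT] at *
  exact (degree_derivative_le).trans_lt hP

/-- A finset version of Rolle's theorem. -/
lemma exists_finset_deriv_eq_zero {f : ℝ → ℝ} (hf : Differentiable ℝ f) (Z : Finset ℝ)
    (hZ : ∀ z ∈ Z, f z = 0) :
    ∃ Z' : Finset ℝ, Z.card ≤ Z'.card + 1 ∧ ∀ z ∈ Z', deriv f z = 0 := by
  suffices h : ∃ Z' : Finset ℝ, Z.card ≤ Z'.card + 1 ∧ (∀ z ∈ Z', deriv f z = 0) ∧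
      ∀ z ∈ Z', ∃ y ∈ Z, z < y by
    obtain ⟨Z', h1, h2, -⟩ := h
    exact ⟨Z', h1, h2⟩
  induction Z using Finset.induction_on_max with
  | empty => exact ⟨∅, by simp⟩
  | insert a s hs ih =>
    obtain ⟨Z', h1, h2, h3⟩ := ih fun z hz => hZ z (Finset.mem_insert_of_mem hz)
    have has : a ∉ s := fun h => lt_irrefl _ (hs a h)
    rcases s.eq_empty_or_nonempty with rfl | hne
    · exact ⟨∅, by simp⟩
    · have hm := s.max'_mem hne
      obtain ⟨c, hc, hc'⟩ := exists_deriv_eq_zero (hs _ hm) hf.continuous.continuousOn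
        (by rw [hZ _ (Finset.mem_insert_of_mem hm), hZ _ (Finset.mem_insert_self _ _)])
      have hcZ : c ∉ Z' := by
        intro h
        obtain ⟨y, hy, hcy⟩ := h3 c h
        exact absurd (hcy.trans_le (s.le_max' y hy)) (not_lt.2 hc.1.le)
      refine ⟨insert c Z', ?_, ?_, ?_⟩
      · rw [Finset.card_insert_of_notMem has, Finset.card_insert_of_notMem hcZ]
        lia
      · simpa [hc'] using h2
      · intro z hz
        rcases Finset.mem_insert.1 hz with rfl | hz
        · exact ⟨a, by simp, hc.2⟩
        · obtain ⟨y, hy, hzy⟩ := h3 z hz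
          exact ⟨y, Finset.mem_insert_of_mem hy, hzy⟩

open Polynomial in
lemma hasDerivAt_sum_eval_mul_exp {ι : Type*} (s : Finset ι) (w : ι → ℝ) (P : ι → ℝ[X]) (x : ℝ) :
    HasDerivAt (fun x => ∑ i ∈ s, (P i).eval x * Real.exp (w i * x))
      (∑ i ∈ s, (expDeriv (w i) (P i)).eval x * Real.exp (w i * x)) x := by
  refine HasDerivAt.fun_sum fun i _ => ?_
  have h1 : HasDerivAt (fun x => Real.exp (w i * x)) (Real.exp (w i * x) * (w i * 1)) x :=
    ((hasDerivAt_id x).const_mul (w i)).exp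
  convert! ((P i).hasDerivAt x).mul h1 using 1
  simp [expDeriv_apply]
  ring

open Polynomial in
lemma exists_finset_iterate_expDeriv_eq_zero {ι : Type*} (s : Finset ι) (w : ι → ℝ)
    (P : ι → ℝ[X]) (Z : Finset ℝ)
    (hZ : ∀ z ∈ Z, ∑ i ∈ s, (P i).eval z * Real.exp (w i * z) = 0) (m : ℕ) :
    ∃ Z' : Finset ℝ, Z.card ≤ Z'.card + m ∧
      ∀ z ∈ Z', ∑ i ∈ s, ((expDeriv (w i))^[m] (P i)).eval z * Real.exp (w i * z) = 0 := by
  induction m with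
  | zero => exact ⟨Z, by simp, by simpa using hZ⟩
  | succ m ih =>
    obtain ⟨Z', h1, h2⟩ := ih
    have hd := hasDerivAt_sum_eval_mul_exp s w (fun i => (expDeriv (w i))^[m] (P i))
    obtain ⟨Z'', h3, h4⟩ := exists_finset_deriv_eq_zero
      (fun x => (hd x).differentiableAt) Z' h2
    refine ⟨Z'', by lia, fun z hz => ?_⟩
    rw [← h4 z hz, (hd z).deriv]
    simp only [Function.iterate_succ_apply']

open Polynomial in
/-- A real exponential polynomial with too many real zeros is trivial. -/
theorem eq_zero_of_sum_eval_mul_exp_eq_zero {ι : Type*} {D : ℕ} (s : Finset ι) (w : ι → ℝ)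
    (hw : Set.InjOn w s) (P : ι → ℝ[X]) (hP : ∀ i ∈ s, (P i).degree < D) (Z : Finset ℝ)
    (hcard : s.card * D ≤ Z.card)
    (hZ : ∀ z ∈ Z, ∑ i ∈ s, (P i).eval z * Real.exp (w i * z) = 0) :
    ∀ i ∈ s, P i = 0 := by
  classical
  induction s using Finset.induction_on generalizing w P Z with
  | empty => simp
  | insert a s has ih =>
    have hZ1 : ∀ z ∈ Z, ∑ i ∈ insert a s, (P i).eval z * Real.exp ((w i - w a) * z) = 0 := by
      intro z hz
      have h := congrArg (· * Real.exp (-(w a * z))) (hZ z hz)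
      simp only [Finset.sum_mul, zero_mul] at h
      rw [← h]
      refine Finset.sum_congr rfl fun i _ => ?_
      rw [mul_assoc, ← Real.exp_add]
      ring_nf
    obtain ⟨Z', h1, h2⟩ := exists_finset_iterate_expDeriv_eq_zero (insert a s)
      (fun i => w i - w a) P Z hZ1 D
    have hPa : (expDeriv (w a - w a))^[D] (P a) = 0 := by
      have : ⇑(expDeriv (w a - w a)) = ⇑(derivative : ℝ[X] →ₗ[ℝ] ℝ[X]) := by
        ext1 p; simp [expDeriv_apply]
      rw [this]
      rcases eq_or_ne (P a) 0 with h | h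
      · simp [h]
      · exact iterate_derivative_eq_zero
          ((natDegree_lt_iff_degree_lt h).2 (hP a (Finset.mem_insert_self _ _)))
    have hs : ∀ i ∈ s, P i = 0 := by
      intro i hi
      have hdeg : ∀ j ∈ s, ((expDeriv (w j - w a))^[D] (P j)).degree < D := by
        intro j hj
        have := hP j (Finset.mem_insert_of_mem hj)
        generalize hm : (expDeriv (w j - w a))^[D] = g
        have key : ∀ m, ((expDeriv (w j - w a))^[m] (P j)).degree < D := by
          intro m
          induction m with
          | zero => simpa using this
          | succ m ihm =>
            rw [Function.iterate_succ_apply']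
            exact degree_expDeriv_lt _ ihm
        exact hm ▸ key D
      have h3 := ih (fun i => w i - w a) (fun x hx y hy hxy => hw (by simp [Finset.mem_coe.1 hx])
        (by simp [Finset.mem_coe.1 hy]) (by simpa using hxy)) _ hdeg Z'
        (by rw [Finset.card_insert_of_notMem has] at hcard; lia)
        (fun z hz => by
          have := h2 z hz
          rw [Finset.sum_insert has, hPa] at this
          simpa using this) i hi
      have hne : w i - w a ≠ 0 := by
        intro h
        have := hw (by simp [hi]) (by simp) (sub_eq_zero.1 h)
        exact has (this ▸ hi)
      have hinj := (expDeriv_injective hne).iterate D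
      apply hinj
      rw [h3]
      clear * -
      induction D with
      | zero => rfl
      | succ m ih => rw [Function.iterate_succ_apply, map_zero, ← ih]
    intro i hi
    rcases Finset.mem_insert.1 hi with rfl | hi
    · refine eq_zero_of_degree_lt_of_eval_finset_eq_zero Z
        ((hP i (Finset.mem_insert_self _ _)).trans_le ?_) fun z hz => ?_
      · rw [Finset.card_insert_of_notMem has] at hcard
        exact_mod_cast (by nlinarith : D ≤ Z.card)
      · have := hZ1 z hz
        rw [Finset.sum_insert has, Finset.sum_eq_zero (fun j hj => by simp [hs j hj])] at this
        simpa using this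
    · exact hs i hi

lemma exists_eq_prod_sub_mul {f : ℂ → ℂ} (hf : Differentiable ℂ f) (Z : Finset ℂ)
    (hZ : ∀ z ∈ Z, f z = 0) :
    ∃ g : ℂ → ℂ, Differentiable ℂ g ∧ ∀ z, f z = (∏ w ∈ Z, (z - w)) * g z := by
  classical
  induction Z using Finset.induction_on with
  | empty => exact ⟨f, hf, by simp⟩
  | insert a s has ih =>
    obtain ⟨g, hg, hfg⟩ := ih fun z hz => hZ z (Finset.mem_insert_of_mem hz)
    have hga : g a = 0 := by
      have h := hZ a (Finset.mem_insert_self _ _)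
      rw [hfg, mul_eq_zero, Finset.prod_eq_zero_iff] at h
      refine h.resolve_left ?_
      rintro ⟨b, hb, hab⟩
      exact has (sub_eq_zero.1 hab ▸ hb)
    refine ⟨dslope g a, ?_, fun z => ?_⟩
    · rw [← differentiableOn_univ] at hg ⊢
      exact (Complex.differentiableOn_dslope Filter.univ_mem).2 hg
    · have h := sub_smul_dslope g a z
      rw [hga, sub_zero, smul_eq_mul] at h
      rw [hfg, Finset.prod_insert has, ← h]
      ring

/-- A Schwarz lemma for functions with many zeros. -/
theorem norm_le_of_zeros {f : ℂ → ℂ} (hf : Differentiable ℂ f) (Z : Finset ℂ)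
    (hZ : ∀ z ∈ Z, f z = 0) {B M : ℝ} (hB : 0 < B) (hZB : ∀ z ∈ Z, ‖z‖ ≤ B)
    (hM : ∀ z, ‖z‖ ≤ 5 * B → ‖f z‖ ≤ M) {x : ℂ} (hx : ‖x‖ ≤ B) :
    ‖f x‖ ≤ M * (1 / 2) ^ Z.card := by
  obtain ⟨g, hg, hfg⟩ := exists_eq_prod_sub_mul hf Z hZ
  have hgx : ‖g x‖ ≤ M / (4 * B) ^ Z.card := by
    refine Complex.norm_le_of_forall_mem_frontier_norm_le (Metric.isBounded_ball (x := (0 : ℂ))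
      (r := 5 * B)) hg.diffContOnCl (fun z hz => ?_) (subset_closure ?_)
    · rw [frontier_ball _ (by positivity), mem_sphere_zero_iff_norm] at hz
      have h1 : (4 * B) ^ Z.card ≤ ‖∏ w ∈ Z, (z - w)‖ := by
        rw [norm_prod, ← Finset.prod_const]
        refine Finset.prod_le_prod (fun _ _ => by positivity) fun w hw => ?_
        have := norm_sub_norm_le z w
        have := hZB w hw
        linarith
      rw [le_div_iff₀ (by positivity), mul_comm]
      calc (4 * B) ^ Z.card * ‖g z‖ ≤ ‖∏ w ∈ Z, (z - w)‖ * ‖g z‖ := by gcongr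
        _ = ‖f z‖ := by rw [hfg, norm_mul]
        _ ≤ M := hM z hz.le
    · rw [mem_ball_zero_iff]
      linarith
  have hprod : ‖∏ w ∈ Z, (x - w)‖ ≤ (2 * B) ^ Z.card := by
    rw [norm_prod, ← Finset.prod_const]
    refine Finset.prod_le_prod (fun _ _ => by positivity) fun w hw => ?_
    have := norm_sub_le x w
    have := hZB w hw
    linarith
  calc ‖f x‖ = ‖∏ w ∈ Z, (x - w)‖ * ‖g x‖ := by rw [hfg, norm_mul]
    _ ≤ (2 * B) ^ Z.card * (M / (4 * B) ^ Z.card) := by gcongr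
    _ = M * (1 / 2) ^ Z.card := by
      rw [show (4 * B) = 2 * (2 * B) by ring, mul_pow 2 (2 * B), one_div, inv_pow]
      field_simp

/-- Siegel's lemma over a number field, for twice as many unknowns as equations. -/
theorem siegel_house (K : Type) [Field K] [NumberField K] :
    ∃ C : ℝ, 1 ≤ C ∧ ∀ (α β : Type) [Fintype α] [Fintype β]
      (a : Matrix α β (NumberField.RingOfIntegers K)) (A : ℝ),
      0 < Fintype.card α → Fintype.card β = 2 * Fintype.card α → a ≠ 0 →
      (∀ k l, NumberField.house (a k l : K) ≤ A) →
      ∃ ξ : β → NumberField.RingOfIntegers K, ξ ≠ 0 ∧ a.mulVec ξ = 0 ∧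
        ∀ l, NumberField.house (ξ l : K) ≤ C * (C * Fintype.card β * A) := by
  classical
  have h : ∃ c : ℝ, ∀ (α β : Type) [Fintype α] [Fintype β]
      (a : Matrix α β (NumberField.RingOfIntegers K)) (A : ℝ),
      0 < Fintype.card α → Fintype.card β = 2 * Fintype.card α → a ≠ 0 →
      (∀ k l, NumberField.house (a k l : K) ≤ A) →
      ∃ ξ : β → NumberField.RingOfIntegers K, ξ ≠ 0 ∧ a.mulVec ξ = 0 ∧
        ∀ l, NumberField.house (ξ l : K) ≤ c * (c * Fintype.card β * A) ^
          ((Fintype.card α : ℝ) / ((Fintype.card β : ℝ) - Fintype.card α)) := by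
    exact ⟨_, fun α β _ _ a A h0 h2 ha hA =>
      NumberField.house.exists_ne_zero_int_vec_house_le K a ha h0 (by lia) rfl hA rfl⟩
  obtain ⟨c, hc⟩ := h
  refine ⟨max 1 |c|, le_max_left _ _, fun α β _ _ a A h0 h2 ha hA => ?_⟩
  obtain ⟨ξ, h3, h4, h5⟩ := hc α β a A h0 h2 ha hA
  refine ⟨ξ, h3, h4, fun l => (h5 l).trans ?_⟩
  have he : (Fintype.card α : ℝ) / ((Fintype.card β : ℝ) - Fintype.card α) = 1 := by
    rw [h2]
    have : (0 : ℝ) < Fintype.card α := by exact_mod_cast h0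
    push_cast
    rw [div_eq_one_iff_eq] <;> linarith
  rw [he, Real.rpow_one]
  have hA0 : 0 ≤ A := by
    have ⟨k⟩ := Fintype.card_pos_iff.1 h0
    have ⟨l⟩ := Fintype.card_pos_iff.1 (show 0 < Fintype.card β by lia)
    exact (NumberField.house_nonneg _).trans (hA k l)
  have hm : c * c ≤ max 1 |c| * max 1 |c| := by
    rw [← abs_mul_abs_self c]
    gcongr <;> exact le_max_right _ _
  calc c * (c * Fintype.card β * A) = (c * c) * (Fintype.card β * A) := by ring
    _ ≤ (max 1 |c| * max 1 |c|) * (Fintype.card β * A) := by gcongr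
    _ = _ := by ring

/-- The value at `s + t b` of the function `z ^ i * 2 ^ (j z)`, scaled by `v ^ (k t)`, when
`2 ^ b` is formally equal to `u / v`. -/
def scaledMonomial {R : Type*} [CommSemiring R] (b : R) (u v k i j s t : ℕ) : R :=
  (s + t * b) ^ i * 2 ^ (j * s) * u ^ (j * t) * v ^ ((k - j) * t)

lemma map_scaledMonomial {R S : Type*} [CommSemiring R] [CommSemiring S] (f : R →+* S) (b : R)
    (u v k i j s t : ℕ) :
    f (scaledMonomial b u v k i j s t) = scaledMonomial (f b) u v k i j s t := by
  have h2 : f 2 = 2 := map_ofNat f 2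
  simp [scaledMonomial, h2]

lemma scaledMonomial_eq {β : ℝ} {u v : ℕ} (hv : 0 < v) (h : (2 : ℝ) ^ β = u / v) {k j : ℕ}
    (hj : j ≤ k) (i s t : ℕ) :
    scaledMonomial β u v k i j s t =
      (v : ℝ) ^ (k * t) * ((s + t * β) ^ i * Real.exp (j * Real.log 2 * (s + t * β))) := by
  have hv' : (v : ℝ) ≠ 0 := by positivity
  have h1 : Real.exp (j * Real.log 2 * (s + t * β)) = 2 ^ (j * s) * (u / v) ^ (j * t) := by
    rw [← h, Real.rpow_def_of_pos two_pos, ← Real.exp_nat_mul]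
    nth_rewrite 2 [← Real.exp_log (two_pos : (0 : ℝ) < 2)]
    rw [← Real.exp_nat_mul, ← Real.exp_add]
    push_cast
    ring_nf
  obtain ⟨l, rfl⟩ := Nat.exists_eq_add_of_le hj
  rw [h1, scaledMonomial, Nat.add_sub_cancel_left, add_mul, pow_add, div_pow]
  field_simp

open NumberField in
lemma house_natCast {K : Type} [Field K] [NumberField K] (n : ℕ) : house (n : K) = n := by
  have := house_intCast (K := K) n
  simpa using this

open NumberField in
lemma house_scaledMonomial_le {K : Type} [Field K] [NumberField K] (b : K) {u v k : ℕ}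
    (hu : 0 < u) (hv : 0 < v) {i j s t : ℕ} (hi : i ≤ 2 * k ^ 3) (hj : j ≤ k)
    (hk : 1 ≤ k) (hs : s ≤ 2 * k ^ 2) (ht : t ≤ 2 * k ^ 2) :
    house (scaledMonomial b u v k i j s t) ≤
      (4 * u * v * (1 + house b) * k ^ 2) ^ (2 * k ^ 3) := by
  have hb := house_nonneg b
  have hu' : (1 : ℝ) ≤ u := by exact_mod_cast hu
  have hv' : (1 : ℝ) ≤ v := by exact_mod_cast hv
  have hk' : (1 : ℝ) ≤ k := by exact_mod_cast hk
  have hbase : house ((s : K) + t * b) ≤ 2 * (1 + house b) * k ^ 2 := by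
    have hs' : (s : ℝ) ≤ 2 * k ^ 2 := by exact_mod_cast hs
    have ht' : (t : ℝ) ≤ 2 * k ^ 2 := by exact_mod_cast ht
    calc house ((s : K) + t * b) ≤ house (s : K) + house (t * b) := house_add_le _ _
      _ = s + t * house b := by rw [house_nat_mul, house_natCast]
      _ ≤ 2 * k ^ 2 + 2 * k ^ 2 * house b := by gcongr
      _ = _ := by ring
  have hexp : ∀ n, n ≤ k → ∀ m ≤ 2 * k ^ 2, n * m ≤ 2 * k ^ 3 := by
    intro n hn m hm
    calc n * m ≤ k * (2 * k ^ 2) := Nat.mul_le_mul hn hm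
      _ = 2 * k ^ 3 := by ring
  have h1 : (1 : ℝ) ≤ 2 * (1 + house b) * k ^ 2 := by
    have : (1 : ℝ) ≤ k ^ 2 := one_le_pow₀ hk'
    nlinarith
  have hpow : ∀ n m : ℕ, house ((n : K) ^ m) = (n : ℝ) ^ m := fun n m => by
    rw [← Nat.cast_pow, house_natCast, Nat.cast_pow]
  calc house (scaledMonomial b u v k i j s t)
      ≤ house ((s : K) + t * b) ^ i * 2 ^ (j * s) * u ^ (j * t) * v ^ ((k - j) * t) := by
        rw [scaledMonomial]
        refine (house_mul_le _ _).trans ?_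
        rw [hpow]
        gcongr
        refine (house_mul_le _ _).trans ?_
        rw [hpow]
        gcongr
        refine (house_mul_le _ _).trans ?_
        have := hpow 2 (j * s)
        rw [Nat.cast_two] at this
        rw [this, Nat.cast_two]
        gcongr
        exact house_pow_le _ _
    _ ≤ (2 * (1 + house b) * k ^ 2) ^ (2 * k ^ 3) * 2 ^ (2 * k ^ 3) * u ^ (2 * k ^ 3) *
          v ^ (2 * k ^ 3) := by
        gcongr ?_ * ?_ * ?_ * ?_
        · exact (pow_le_pow_left₀ (house_nonneg _) hbase _).trans (pow_le_pow_right₀ h1 hi)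
        · exact pow_le_pow_right₀ one_le_two (hexp _ hj _ hs)
        · exact pow_le_pow_right₀ hu' (hexp _ hj _ ht)
        · exact pow_le_pow_right₀ hv' (hexp _ (Nat.sub_le _ _) _ ht)
    _ = _ := by
        simp only [← mul_pow]
        ring

open Polynomial in
/-- A linear combination of the functions `x ^ i * 2 ^ (j x)` with `i < D`, `j < k` having at least
`D k` real zeros is trivial. -/
lemma eq_zero_of_sum_pow_mul_exp_eq_zero {D k : ℕ} (c : Fin D × Fin k → ℝ) (Z : Finset ℝ)
    (hcard : k * D ≤ Z.card)
    (hZ : ∀ x ∈ Z, ∑ p, c p * (x ^ (p.1 : ℕ) * Real.exp (p.2 * Real.log 2 * x)) = 0) : c = 0 := by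
  have hlog : Real.log 2 ≠ 0 := (Real.log_pos one_lt_two).ne'
  have h := eq_zero_of_sum_eval_mul_exp_eq_zero (D := D) (Finset.univ : Finset (Fin k))
    (fun j => j * Real.log 2)
    (fun a _ b _ hab => by simpa [hlog, Fin.ext_iff] using hab)
    (fun j => ∑ i : Fin D, monomial (i : ℕ) (c (i, j)))
    (fun j _ => by
      rw [← mem_degreeLT]
      refine Submodule.sum_mem _ fun i _ => mem_degreeLT.2 ?_
      exact (degree_monomial_le _ _).trans_lt (by exact_mod_cast i.2))
    Z (by simpa using hcard) (fun x hx => by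
      rw [← hZ x hx, Fintype.sum_prod_type_right]
      refine Finset.sum_congr rfl fun j _ => ?_
      rw [eval_finsetSum, Finset.sum_mul]
      refine Finset.sum_congr rfl fun i _ => ?_
      rw [eval_monomial, mul_assoc])
  funext ⟨i, j⟩
  have h2 := congrArg (fun P => coeff P (i : ℕ)) (h j (Finset.mem_univ _))
  simpa [coeff_monomial, Fin.val_inj] using h2

lemma card_image_grid {β : ℝ} (hβ : Irrational β) (S : ℕ) :
    ((Finset.range S ×ˢ Finset.range S).image fun p : ℕ × ℕ => (p.1 + p.2 * β : ℝ)).card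
      = S ^ 2 := by
  rw [Finset.card_image_of_injective, Finset.card_product, Finset.card_range, sq]
  rintro ⟨s, t⟩ ⟨s', t'⟩ h
  simp only at h
  have ht : t = t' := by
    by_contra hne
    have hne' : ((t : ℤ) - t' : ℤ) ≠ 0 := by lia
    have h1 := hβ.intCast_mul hne'
    apply h1
    exact ⟨(s' - s : ℤ), by push_cast; linarith⟩
  subst ht
  simpa using h

lemma norm_sum_pow_mul_exp_le {D k : ℕ} (c : Fin D × Fin k → ℝ) {X R : ℝ} (hX : ∀ p, |c p| ≤ X)
    (hR : 1 ≤ R) {z : ℂ} (hz : ‖z‖ ≤ R) :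
    ‖∑ p, (c p : ℂ) * (z ^ (p.1 : ℕ) * Complex.exp (p.2 * Real.log 2 * z))‖ ≤
      (D * k : ℕ) * (X * (R ^ D * Real.exp (k * R))) := by
  have hterm : ∀ p : Fin D × Fin k,
      ‖(c p : ℂ) * (z ^ (p.1 : ℕ) * Complex.exp (p.2 * Real.log 2 * z))‖ ≤
        X * (R ^ D * Real.exp (k * R)) := by
    intro p
    rw [norm_mul, norm_mul, norm_pow, Complex.norm_exp, Complex.norm_real, Real.norm_eq_abs]
    have h1 : ‖z‖ ^ (p.1 : ℕ) ≤ R ^ D :=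
      (pow_le_pow_left₀ (norm_nonneg _) hz _).trans (pow_le_pow_right₀ hR p.1.2.le)
    have h2 : ((p.2 : ℂ) * Real.log 2 * z).re ≤ k * R := by
      refine (Complex.re_le_norm _).trans ?_
      rw [norm_mul, norm_mul, Complex.norm_natCast, Complex.norm_real, Real.norm_eq_abs,
        abs_of_pos (Real.log_pos one_lt_two)]
      have h3 : ((p.2 : ℕ) : ℝ) ≤ k := by exact_mod_cast p.2.2.le
      have h4 : Real.log 2 ≤ 1 := by linarith [Real.log_two_lt_d9]
      have h5 := Real.log_pos (one_lt_two (α := ℝ))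
      calc _ ≤ (k : ℝ) * 1 * R := by gcongr
        _ = k * R := by ring
    have := (abs_nonneg _).trans (hX p)
    gcongr
    exact hX p
  refine (norm_sum_le_of_le _ fun p _ => hterm p).trans ?_
  simp

lemma exists_lt_two_pow (C : ℝ) (m : ℕ) : ∃ k : ℕ, 1 ≤ k ∧ (C * k ^ 2) ^ m < 2 ^ k := by
  have h := (tendsto_pow_const_div_const_pow_of_one_lt (2 * m) (one_lt_two (α := ℝ))).const_mul
    (C ^ m)
  rw [mul_zero] at h
  obtain ⟨k, hk, hk1⟩ := ((h.eventually_lt_const one_pos).and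
    (Filter.eventually_ge_atTop 1)).exists
  refine ⟨k, hk1, ?_⟩
  rw [← mul_div_assoc, div_lt_one (by positivity)] at hk
  rwa [mul_pow, ← pow_mul]

open NumberField in
lemma one_le_abs_mul_house_pow {K : Type} [Field K] [NumberField K] (ρ : K →+* ℝ) {y : 𝓞 K}
    (hy : y ≠ 0) : 1 ≤ |ρ y| * house (y : K) ^ (Module.finrank ℚ K - 1) := by
  have h := norm_norm_le_norm_mul_house_pow (y : K) (Complex.ofRealHom.comp ρ)
  have h1 : (1 : ℝ) ≤ ‖Algebra.norm ℚ (y : K)‖ := by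
    rw [← Algebra.coe_norm_int, ← Rat.norm_cast_real]
    simp only [Rat.cast_intCast, Real.norm_eq_abs]
    have : Algebra.norm ℤ y ≠ 0 := Algebra.norm_ne_zero_iff.2 hy
    exact_mod_cast Int.one_le_abs this
  refine h1.trans (h.trans_eq ?_)
  simp

open NumberField in
/-- The construction of an auxiliary function: an exponential polynomial with small coefficients
vanishing on the grid of points `s + t b` with `s, t < k ^ 2`. -/
lemma exists_auxiliary_coeffs (K : Type) [Field K] [NumberField K] (b : 𝓞 K) {u v : ℕ}
    (hu : 0 < u) (hv : 0 < v) :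
    ∃ c : ℝ, 1 ≤ c ∧ ∀ k : ℕ, 1 ≤ k → ∃ ξ : Fin (2 * k ^ 3) × Fin k → 𝓞 K, ξ ≠ 0 ∧
      (∀ s < k ^ 2, ∀ t < k ^ 2, ∑ p, ξ p * scaledMonomial b u v k p.1 p.2 s t = 0) ∧
      ∀ p, house (ξ p : K) ≤
        c * (c * (2 * k ^ 4) * (4 * u * v * (1 + house (b : K)) * k ^ 2) ^ (2 * k ^ 3)) := by
  obtain ⟨c, hc, h⟩ := siegel_house K
  refine ⟨c, hc, fun k hk => ?_⟩
  have hmap (i j s t : ℕ) : ((scaledMonomial b u v k i j s t : 𝓞 K) : K) =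
      scaledMonomial (b : K) u v k i j s t :=
    map_scaledMonomial (algebraMap (𝓞 K) K) b u v k i j s t
  have hcard : Fintype.card (Fin (2 * k ^ 3) × Fin k) =
      2 * Fintype.card (Fin (k ^ 2) × Fin (k ^ 2)) := by
    simp only [Fintype.card_prod, Fintype.card_fin]
    ring
  have hne : (Matrix.of fun (q : Fin (k ^ 2) × Fin (k ^ 2)) (p : Fin (2 * k ^ 3) × Fin k) =>
      scaledMonomial b u v k p.1 p.2 q.1 q.2) ≠ 0 := by
    intro h0
    have h1 := congrFun (congrFun h0 (⟨0, by positivity⟩, ⟨0, by positivity⟩))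
      (⟨0, by positivity⟩, ⟨0, by positivity⟩)
    simp [scaledMonomial] at h1
  obtain ⟨ξ, h1, h2, h3⟩ := h _ _ _ ((4 * u * v * (1 + house (b : K)) * k ^ 2) ^ (2 * k ^ 3))
    (by simp only [Fintype.card_prod, Fintype.card_fin]; positivity) hcard hne (by
      intro q p
      rw [Matrix.of_apply, hmap]
      exact house_scaledMonomial_le _ hu hv p.1.2.le p.2.2.le hk (by lia) (by lia))
  refine ⟨ξ, h1, fun s hs t ht => ?_, fun p => (h3 p).trans_eq ?_⟩
  · have := congrFun h2 (⟨s, hs⟩, ⟨t, ht⟩)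
    simp only [Matrix.mulVec, dotProduct, Matrix.of_apply, Pi.zero_apply] at this
    rw [← this]
    exact Finset.sum_congr rfl fun p _ => mul_comm _ _
  · simp only [Fintype.card_prod, Fintype.card_fin]
    push_cast
    ring

lemma pow_mul_pow_lt_one {C : ℝ} {k d : ℕ} (hC : 0 ≤ C) (hk : 1 ≤ k)
    (h : (C * k ^ 2) ^ (2 * (8 + 6 * (d - 1))) < 2 ^ k) :
    ((C * k ^ 2) ^ (2 * k ^ 3) * (((C * k ^ 2) ^ (2 * k ^ 3)) ^ 7 * (1 / 2) ^ (k ^ 4))) *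
      (((C * k ^ 2) ^ (2 * k ^ 3)) ^ 6) ^ (d - 1) < 1 := by
  have hlt : ((C * k ^ 2) ^ (2 * (8 + 6 * (d - 1))) / 2 ^ k) ^ (k ^ 3) < 1 :=
    pow_lt_one₀ (by positivity) (by rwa [div_lt_one (by positivity)]) (by positivity)
  refine lt_of_eq_of_lt ?_ hlt
  generalize C * (k : ℝ) ^ 2 = x
  generalize d - 1 = m
  have hx : x ^ (2 * k ^ 3) * (x ^ (2 * k ^ 3)) ^ 7 * ((x ^ (2 * k ^ 3)) ^ 6) ^ m =
      (x ^ (2 * (8 + 6 * m))) ^ (k ^ 3) := by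
    simp only [← pow_mul, ← pow_add]
    congr 1
    ring
  rw [one_div, inv_pow, div_pow, ← hx, ← pow_mul 2 k, show k * k ^ 3 = k ^ 4 by ring]
  ring

lemma exists_parameters {c A E v : ℝ} (hc : 0 ≤ c) (hA : 0 ≤ A) (hE : 0 ≤ E) (hv : 1 ≤ v)
    (d : ℕ) :
    ∃ (k : ℕ) (T : ℝ), 1 ≤ k ∧ 1 ≤ T ∧ c ≤ T ∧ 2 * (k : ℝ) ^ 4 ≤ T ∧
      (A * k ^ 2) ^ (2 * k ^ 3) ≤ T ∧ (E * k ^ 2) ^ (2 * k ^ 3) ≤ T ∧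
      Real.exp (k * (E * k ^ 2)) ≤ T ∧ (∀ t ≤ 2 * k ^ 2, v ^ (k * t) ≤ T) ∧
      (T * (T ^ 7 * (1 / 2) ^ (k ^ 4))) * (T ^ 6) ^ (d - 1) < 1 := by
  set C : ℝ := 2 + c + A + E + v + Real.exp E with hC
  have hexp0 := Real.exp_pos E
  obtain ⟨k, hk, hklt⟩ := exists_lt_two_pow C (2 * (8 + 6 * (d - 1)))
  have hk1 : (1 : ℝ) ≤ k := by exact_mod_cast hk
  have hk2 : (1 : ℝ) ≤ (k : ℝ) ^ 2 := one_le_pow₀ hk1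
  have hC1 : 1 ≤ C := by linarith
  have hCk : C ≤ C * k ^ 2 := le_mul_of_one_le_right (by linarith) hk2
  have hk3 : 1 ≤ k ^ 3 := Nat.one_le_pow _ _ hk
  set T : ℝ := (C * k ^ 2) ^ (2 * k ^ 3) with hT
  have hT1 : 1 ≤ T := one_le_pow₀ (hC1.trans hCk)
  have hCT : C ≤ T := hCk.trans (le_self_pow₀ (hC1.trans hCk) (by lia))
  have hqT : (2 * k ^ 4 : ℝ) ≤ T := by
    calc (2 * k ^ 4 : ℝ) ≤ (C * k ^ 2) ^ 2 := by
          rw [mul_pow, ← pow_mul]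
          gcongr
          nlinarith
      _ ≤ T := pow_le_pow_right₀ (hC1.trans hCk) (by lia)
  refine ⟨k, T, hk, hT1, by linarith, hqT, ?_, ?_, ?_, ?_,
    pow_mul_pow_lt_one (by linarith) hk hklt⟩
  · rw [hT]; gcongr; linarith
  · rw [hT]; gcongr; linarith
  · rw [show (k * (E * k ^ 2) : ℝ) = (k ^ 3 : ℕ) * E by push_cast; ring, Real.exp_nat_mul]
    calc Real.exp E ^ (k ^ 3) ≤ (C * k ^ 2) ^ (k ^ 3) := by gcongr; linarith
      _ ≤ T := pow_le_pow_right₀ (hC1.trans hCk) (by lia)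
  · intro t ht
    calc v ^ (k * t) ≤ v ^ (2 * k ^ 3) :=
          pow_le_pow_right₀ hv (by nlinarith [Nat.mul_le_mul_left k ht])
      _ ≤ T := by rw [hT]; gcongr; linarith

open NumberField in
lemma gelfond_schneider_two_aux {K : Type} [Field K] [NumberField K] (ρ : K →+* ℝ) (b : 𝓞 K)
    (hirr : Irrational (ρ b)) {u v : ℕ} (hu : 0 < u) (hv : 0 < v) :
    (2 : ℝ) ^ (ρ b) ≠ u / v := by
  intro hpow
  obtain ⟨c, hc, haux⟩ := exists_auxiliary_coeffs K b hu hv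
  set β : ℝ := ρ b with hβ
  have hH := house_nonneg (b : K)
  have hu1 : (1 : ℝ) ≤ u := by exact_mod_cast hu
  have hv1 : (1 : ℝ) ≤ v := by exact_mod_cast hv
  set d := Module.finrank ℚ K
  set A : ℝ := 4 * u * v * (1 + house (b : K)) with hA
  set E : ℝ := 10 * (1 + |β|) with hE
  have hE0 : 0 ≤ E := by positivity
  have hA0 : 0 ≤ A := by positivity
  obtain ⟨k, T, hk, hT1, hcT, hqT, hAT, hET, hexpT, hvT, hlt⟩ :=
    exists_parameters (zero_le_one.trans hc) hA0 hE0 hv1 d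
  have hk1 : (1 : ℝ) ≤ k := by exact_mod_cast hk
  have hk2 : (1 : ℝ) ≤ (k : ℝ) ^ 2 := one_le_pow₀ hk1
  obtain ⟨ξ, hξ0, hξgrid, hξ⟩ := haux k hk
  have hξT : ∀ p, house (ξ p : K) ≤ T ^ 4 := by
    intro p
    calc house (ξ p : K) ≤ c * (c * (2 * k ^ 4) * (A * k ^ 2) ^ (2 * k ^ 3)) := hξ p
      _ ≤ T * (T * T * T) := by gcongr
      _ = T ^ 4 := by ring
  have hρξ : ∀ p, |ρ (ξ p)| ≤ T ^ 4 := fun p => by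
    refine le_trans ?_ (hξT p)
    simpa using norm_embedding_le_house (ξ p : K) (Complex.ofRealHom.comp ρ)
  set y : ℕ → ℕ → 𝓞 K := fun s t => ∑ p, ξ p * scaledMonomial b u v k p.1 p.2 s t with hy
  set F : ℝ → ℝ := fun x =>
    ∑ p, ρ (ξ p) * (x ^ (p.1 : ℕ) * Real.exp (p.2 * Real.log 2 * x)) with hF
  set G : ℂ → ℂ := fun z =>
    ∑ p, ((ρ (ξ p) : ℝ) : ℂ) * (z ^ (p.1 : ℕ) * Complex.exp (p.2 * Real.log 2 * z)) with hG
  have hGF : ∀ x : ℝ, G x = F x := fun x => by simp [hG, hF]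
  have hyF : ∀ s t, ρ (y s t) = v ^ (k * t) * F (s + t * β) := by
    intro s t
    simp only [hy, hF, map_sum, map_mul, Finset.mul_sum]
    refine Finset.sum_congr rfl fun p _ => ?_
    have := map_scaledMonomial (ρ.comp (algebraMap (𝓞 K) K)) b u v k p.1 p.2 s t
    simp only [RingHom.comp_apply] at this
    rw [this, ← hβ, scaledMonomial_eq hv hpow p.2.2.le]
    ring
  have hyhouse : ∀ s ≤ 2 * k ^ 2, ∀ t ≤ 2 * k ^ 2, house (y s t : K) ≤ T ^ 6 := by
    intro s hs t ht
    have hterm : ∀ p : Fin (2 * k ^ 3) × Fin k,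
        house ((ξ p * scaledMonomial b u v k p.1 p.2 s t : 𝓞 K) : K) ≤ T ^ 5 := by
      intro p
      have hmul : ((ξ p * scaledMonomial b u v k p.1 p.2 s t : 𝓞 K) : K) =
          ξ p * scaledMonomial (b : K) u v k p.1 p.2 s t := by
        rw [← map_scaledMonomial (algebraMap (𝓞 K) K)]
        exact map_mul (algebraMap (𝓞 K) K) _ _
      rw [hmul]
      refine (house_mul_le _ _).trans ?_
      calc _ ≤ T ^ 4 * (A * k ^ 2) ^ (2 * k ^ 3) :=
            mul_le_mul (hξT p) (house_scaledMonomial_le _ hu hv p.1.2.le p.2.2.le hk hs ht)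
              (house_nonneg _) (by positivity)
        _ ≤ T ^ 4 * T := by gcongr
        _ = T ^ 5 := by ring
    calc house (y s t : K) ≤ ∑ p : Fin (2 * k ^ 3) × Fin k, T ^ 5 := by
          simp only [hy, map_sum]
          refine (house_sum_le_sum_house _ _).trans (Finset.sum_le_sum fun p _ => ?_)
          exact hterm p
      _ = (2 * k ^ 4) * T ^ 5 := by
          simp only [Finset.sum_const, Finset.card_univ, Fintype.card_prod, Fintype.card_fin,
            nsmul_eq_mul]
          push_cast
          ring
      _ ≤ T * T ^ 5 := by gcongr
      _ = T ^ 6 := by ring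
  have hρ0 : ρ ((0 : 𝓞 K) : K) = 0 := by simp
  have hvanish : ∀ s < k ^ 2, ∀ t < k ^ 2, F (s + t * β) = 0 := by
    intro s hs t ht
    have h := hyF s t
    rw [show y s t = 0 from hξgrid s hs t ht, hρ0, eq_comm, mul_eq_zero] at h
    exact h.resolve_left (by positivity)
  have hgridle : ∀ s ≤ 2 * k ^ 2, ∀ t ≤ 2 * k ^ 2,
      ‖((s + t * β : ℝ) : ℂ)‖ ≤ 2 * (1 + |β|) * k ^ 2 := by
    intro s hs t ht
    have hs' : (s : ℝ) ≤ 2 * k ^ 2 := by exact_mod_cast hs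
    have ht' : (t : ℝ) ≤ 2 * k ^ 2 := by exact_mod_cast ht
    rw [Complex.norm_real, Real.norm_eq_abs]
    calc |(s : ℝ) + t * β| ≤ |(s : ℝ)| + |t * β| := abs_add_le _ _
      _ = s + t * |β| := by rw [abs_mul, Nat.abs_cast, Nat.abs_cast]
      _ ≤ 2 * k ^ 2 + 2 * k ^ 2 * |β| := by gcongr
      _ = _ := by ring
  have hsmall : ∀ s ≤ 2 * k ^ 2, ∀ t ≤ 2 * k ^ 2,
      |F (s + t * β)| ≤ T ^ 7 * (1 / 2) ^ (k ^ 4) := by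
    intro s hs t ht
    set Z : Finset ℂ := ((Finset.range (k ^ 2) ×ˢ Finset.range (k ^ 2)).image
      fun p : ℕ × ℕ => (p.1 + p.2 * β : ℝ)).image Complex.ofReal with hZ
    have hZcard : Z.card = k ^ 4 := by
      rw [hZ, Finset.card_image_of_injective _ Complex.ofReal_injective, card_image_grid hirr]
      ring
    have hZmem : ∀ z ∈ Z, ∃ s < k ^ 2, ∃ t < k ^ 2, z = ((s + t * β : ℝ) : ℂ) := by
      intro z hz
      simp only [hZ, Finset.mem_image, Finset.mem_product, Finset.mem_range, Prod.exists] at hz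
      obtain ⟨_, ⟨s, t, ⟨hs, ht⟩, rfl⟩, rfl⟩ := hz
      exact ⟨s, hs, t, ht, rfl⟩
    have h := norm_le_of_zeros (f := G) (by fun_prop) Z (fun z hz => by
        obtain ⟨s, hs, t, ht, rfl⟩ := hZmem z hz
        rw [hGF, hvanish s hs t ht, Complex.ofReal_zero])
      (B := 2 * (1 + |β|) * k ^ 2) (M := T ^ 7) (by positivity) (fun z hz => by
        obtain ⟨s, hs, t, ht, rfl⟩ := hZmem z hz
        exact hgridle s (by lia) t (by lia)) (fun z hz => by
        have hR : 1 ≤ E * k ^ 2 := by nlinarith [abs_nonneg β]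
        have h1 := norm_sum_pow_mul_exp_le (fun p => ρ (ξ p)) hρξ hR
          (hz.trans_eq (by rw [hE]; ring))
        refine h1.trans ?_
        calc _ = (2 * k ^ 4 : ℝ) * (T ^ 4 * ((E * k ^ 2) ^ (2 * k ^ 3) *
              Real.exp (k * (E * k ^ 2)))) := by push_cast; ring
          _ ≤ T * (T ^ 4 * (T * T)) := by gcongr
          _ = T ^ 7 := by ring) (hgridle s hs t ht)
    rwa [hGF, hZcard, Complex.norm_real, Real.norm_eq_abs] at h
  have hzero : ∀ s ≤ 2 * k ^ 2, ∀ t ≤ 2 * k ^ 2, F (s + t * β) = 0 := by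
    intro s hs t ht
    by_contra hne
    have hy0 : y s t ≠ 0 := by
      intro h0
      have h := hyF s t
      rw [h0, hρ0, eq_comm, mul_eq_zero] at h
      exact hne (h.resolve_left (by positivity))
    have h1 := one_le_abs_mul_house_pow ρ hy0
    have h2 : |ρ (y s t)| * house (y s t : K) ^ (d - 1) ≤
        (T * (T ^ 7 * (1 / 2) ^ (k ^ 4))) * (T ^ 6) ^ (d - 1) := by
      rw [hyF, abs_mul, abs_of_pos (by positivity : (0 : ℝ) < v ^ (k * t))]
      have h3 := hvT t ht
      have h4 := hsmall s hs t ht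
      have h5 := hyhouse s hs t ht
      have h6 := house_nonneg (y s t : K)
      gcongr
    exact absurd (h1.trans h2) (not_le.2 hlt)
  have hc0 := eq_zero_of_sum_pow_mul_exp_eq_zero (fun p => ρ (ξ p))
    ((Finset.range (2 * k ^ 2) ×ˢ Finset.range (2 * k ^ 2)).image
      fun p : ℕ × ℕ => (p.1 + p.2 * β : ℝ))
    (by rw [card_image_grid hirr]; nlinarith [Nat.zero_le (k ^ 4)]) (fun x hx => by
      simp only [Finset.mem_image, Finset.mem_product, Finset.mem_range, Prod.exists] at hx
      obtain ⟨s, t, ⟨hs, ht⟩, rfl⟩ := hx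
      exact hzero s hs.le t ht.le)
  apply hξ0
  funext p
  have := congrFun hc0 p
  simpa using this

open NumberField IntermediateField in
/-- A special case of the Gelfond-Schneider theorem. -/
theorem gelfond_schneider_two {β : ℝ} (hβ : IsIntegral ℤ β) (hirr : Irrational β) {u v : ℕ}
    (hu : 0 < u) (hv : 0 < v) : (2 : ℝ) ^ β ≠ u / v := by
  have : FiniteDimensional ℚ ℚ⟮β⟯ := adjoin.finiteDimensional hβ.tower_top
  have : NumberField ℚ⟮β⟯ := ⟨⟩
  have hint : IsIntegral ℤ (AdjoinSimple.gen ℚ β) :=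
    (isIntegral_algHom_iff (ℚ⟮β⟯.val.restrictScalars ℤ) ℚ⟮β⟯.val.injective).1 hβ
  exact gelfond_schneider_two_aux (ℚ⟮β⟯.val : ℚ⟮β⟯ →+* ℝ) ⟨AdjoinSimple.gen ℚ β, hint⟩ hirr hu hv

lemma eq_one_and_eq_one_of_pow_eq {m l c e f : ℕ} (hm : 0 < m) (hl : 0 < l) (hc : 0 < c)
    (hml : m.Coprime l)
    (h : (m + l) ^ ((m + l) * c) * 2 ^ e = (m ^ m * l ^ l) ^ c * 2 ^ f) : m = 1 ∧ l = 1 := by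
  have hdvd : ∀ q, q.Prime → q ≠ 2 → (q ∣ m + l ↔ q ∣ m ∨ q ∣ l) := by
    intro q hq hq2
    have hq2' : ∀ n, ¬ q ∣ 2 ^ n := fun n hn =>
      hq2 ((Nat.prime_dvd_prime_iff_eq hq Nat.prime_two).1 (hq.dvd_of_dvd_pow hn))
    have hpow : ∀ a n, 0 < n → (q ∣ a ^ n ↔ q ∣ a) := fun a n hn =>
      ⟨hq.dvd_of_dvd_pow, fun ha => dvd_pow ha hn.ne'⟩
    have h1 : q ∣ (m + l) ^ ((m + l) * c) * 2 ^ e ↔ q ∣ (m ^ m * l ^ l) ^ c * 2 ^ f := by rw [h]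
    rw [hq.dvd_mul, hq.dvd_mul, hpow _ _ (by positivity), hpow _ _ hc, hq.dvd_mul, hpow _ _ hm,
      hpow _ _ hl] at h1
    simpa [hq2'] using h1
  have hodd : ∀ q, q.Prime → q ∣ m ∨ q ∣ l → q = 2 := by
    intro q hq hql
    by_contra hq2
    have h1 := (hdvd q hq hq2).2 hql
    have : q ∣ m ∧ q ∣ l := by
      rcases hql with hqm | hql
      · exact ⟨hqm, (Nat.dvd_add_right hqm).1 h1⟩
      · exact ⟨(Nat.dvd_add_left hql).1 h1, hql⟩
    exact hq.one_lt.ne' (Nat.eq_one_of_dvd_coprimes hml this.1 this.2)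
  have h2 : 2 ∣ m + l := by
    obtain ⟨q, hq, hqn⟩ := Nat.exists_prime_and_dvd (show m + l ≠ 1 by lia)
    rcases eq_or_ne q 2 with rfl | hq2
    · exact hqn
    · exact absurd (hodd q hq ((hdvd q hq hq2).1 hqn)) hq2
  have h3 : ¬ (2 ∣ m ∧ 2 ∣ l) := fun ⟨ha, hb⟩ => by
    have := Nat.eq_one_of_dvd_coprimes hml ha hb
    lia
  constructor
  · by_contra hne
    obtain ⟨q, hq, hqn⟩ := Nat.exists_prime_and_dvd hne
    obtain rfl := hodd q hq (Or.inl hqn)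
    lia
  · by_contra hne
    obtain ⟨q, hq, hqn⟩ := Nat.exists_prime_and_dvd hne
    obtain rfl := hodd q hq (Or.inr hqn)
    lia

lemma two_rpow_mul_binH {m l : ℕ} (hm : 0 < m) (hl : 0 < l) :
    (2 : ℝ) ^ (((m + l : ℕ) : ℝ) * binH ((m : ℝ) / (m + l : ℕ))) =
      ((m + l) ^ (m + l) : ℕ) / (m ^ m * l ^ l : ℕ) := by
  have hm' : (0 : ℝ) < m := by exact_mod_cast hm
  have hl' : (0 : ℝ) < l := by exact_mod_cast hl
  have h1 : 1 - (m : ℝ) / (m + l : ℕ) = l / (m + l : ℕ) := by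
    push_cast
    field_simp
    ring
  have h2 : ((m + l : ℕ) : ℝ) * binH ((m : ℝ) / (m + l : ℕ)) =
      Real.logb 2 (((m + l) ^ (m + l) : ℕ) / (m ^ m * l ^ l : ℕ)) := by
    rw [binH, h1]
    push_cast
    rw [Real.logb_div hm'.ne' (by positivity), Real.logb_div hl'.ne' (by positivity),
      Real.logb_div (by positivity) (by positivity), Real.logb_mul (by positivity) (by positivity),
      Real.logb_pow, Real.logb_pow, Real.logb_pow]
    push_cast
    field_simp
    ring
  rw [h2, Real.rpow_logb two_pos (by norm_num) (by positivity)]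

theorem binH_transcendental (p : ℚ) (h0 : 0 < p) (h1 : p < 1) (hhalf : p ≠ 1 / 2) :
    Transcendental ℤ (binH (p : ℝ)) := by
  intro halg
  obtain ⟨m, l, hm, hl, hml, hp⟩ : ∃ m l : ℕ, 0 < m ∧ 0 < l ∧ m.Coprime l ∧
      p = m / (m + l : ℕ) := by
    have hnum : 0 < p.num := Rat.num_pos.2 h0
    have hlt : p.num < p.den := Rat.num_lt_denom_iff.2 h1
    obtain ⟨l, hl⟩ := Nat.exists_eq_add_of_le (show p.num.natAbs ≤ p.den by lia)
    refine ⟨p.num.natAbs, l, by lia, by lia, ?_, ?_⟩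
    · have := p.reduced
      rw [hl] at this
      simpa using this
    · rw [← hl]
      have : ((p.num.natAbs : ℕ) : ℚ) = p.num := by
        rw [← Int.cast_natCast, Int.natAbs_of_nonneg hnum.le]
      rw [this, Rat.num_div_den]
  obtain ⟨c, hc, hint⟩ : ∃ c : ℕ, 0 < c ∧ IsIntegral ℤ ((c : ℝ) * binH p) := by
    obtain ⟨y, hy, hint⟩ := halg.exists_integral_multiple
    refine ⟨y.natAbs, Int.natAbs_pos.2 hy, ?_⟩
    rw [zsmul_eq_mul] at hint
    rcases Int.natAbs_eq y with h | h
    · rw [h] at hint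
      simpa using hint
    · rw [h] at hint
      simpa using hint.neg
  set β : ℝ := (m + l : ℕ) * (c * binH p) with hβ
  have hβint : IsIntegral ℤ β := (isIntegral_algebraMap (x := ((m + l : ℕ) : ℤ))).mul hint
  have hpow : (2 : ℝ) ^ β = (((m + l) ^ (m + l)) ^ c : ℕ) / ((m ^ m * l ^ l) ^ c : ℕ) := by
    have h := two_rpow_mul_binH hm hl
    have hp' : (p : ℝ) = (m : ℝ) / (m + l : ℕ) := by rw [hp]; push_cast; rfl
    rw [hβ, hp', show ((m + l : ℕ) : ℝ) * (c * binH ((m : ℝ) / (m + l : ℕ))) =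
      ((m + l : ℕ) * binH ((m : ℝ) / (m + l : ℕ))) * (c : ℕ) by ring,
      Real.rpow_mul_natCast two_pos.le, h, div_pow]
    push_cast
    rfl
  have hrat : ¬ Irrational β := fun hirr =>
    gelfond_schneider_two hβint hirr (by positivity) (by positivity) hpow
  obtain ⟨r, hr⟩ := not_not.1 hrat
  have hrint : IsIntegral ℤ r := by
    rw [← hr] at hβint
    exact (isIntegral_algebraMap_iff (algebraMap ℚ ℝ).injective).1 hβint
  obtain ⟨e, he⟩ := IsIntegrallyClosed.isIntegral_iff.1 hrint
  have hβe : β = e := by rw [← hr, ← he]; simp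
  have hkey : (m + l) ^ ((m + l) * c) * 2 ^ ((-e).toNat) = (m ^ m * l ^ l) ^ c * 2 ^ e.toNat := by
    rw [hβe, Real.rpow_intCast, eq_div_iff (by positivity)] at hpow
    have h2 : (2 : ℝ) ^ e * 2 ^ (-e).toNat = 2 ^ e.toNat := by
      rw [← zpow_natCast, ← zpow_natCast, ← zpow_add₀ two_ne_zero]
      congr 1
      lia
    have h3 : (((m + l) ^ ((m + l) * c) * 2 ^ ((-e).toNat) : ℕ) : ℝ) =
        ((m ^ m * l ^ l) ^ c * 2 ^ e.toNat : ℕ) := by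
      rw [pow_mul, Nat.cast_mul, ← hpow, Nat.cast_mul, Nat.cast_pow 2, Nat.cast_pow 2,
        Nat.cast_two, ← h2]
      ring
    exact_mod_cast h3
  obtain ⟨rfl, rfl⟩ := eq_one_and_eq_one_of_pow_eq hm hl hc hml hkey
  exact hhalf (by rw [hp]; norm_num)
end

section
/- For rational ε ∈ (0, 1/2), the capacity of the binary symmetric channel C_BSC(ε) = 1 − h₂(ε) is a transcendental number. -/
open Finset in
/-- Rolle's theorem, counting zeros: a differentiable function has at most one more zero than its
derivative. -/
theorem exists_card_zeros_deriv {f f' : ℝ → ℝ} (hf : ∀ x, HasDerivAt f (f' x) x)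
    {n : ℕ} (Z : Finset ℝ) (hcard : n + 1 ≤ #Z) (hZ : ∀ x ∈ Z, f x = 0) :
    ∃ Z' : Finset ℝ, n ≤ #Z' ∧ ∀ x ∈ Z', f' x = 0 := by
  obtain ⟨W, hWZ, hW⟩ := exists_subset_card_eq hcard
  set z := W.orderEmbOfFin hW
  have hz (i) : f (z i) = 0 := hZ _ (hWZ (W.orderEmbOfFin_mem hW i))
  have hrolle (i : Fin n) : ∃ c ∈ Set.Ioo (z i.castSucc) (z i.succ), f' c = 0 :=
    exists_hasDerivAt_eq_zero (z.strictMono i.castSucc_lt_succ)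
      (fun x _ ↦ (hf x).continuousAt.continuousWithinAt) (by rw [hz, hz]) fun x _ ↦ hf x
  choose c hc hc' using hrolle
  have hmono : StrictMono c := by
    intro i j hij
    have h : z i.succ ≤ z j.castSucc := z.monotone (Fin.succ_le_castSucc_iff.2 hij)
    exact ((hc i).2.trans_le h).trans (hc j).1
  refine ⟨univ.image c, ?_, ?_⟩
  · rw [card_image_of_injective _ hmono.injective, card_univ, Fintype.card_fin]
  · intro x hx
    obtain ⟨i, -, rfl⟩ := mem_image.1 hx
    exact hc' i

open Finset Polynomial in
/-- A real exponential polynomial with at least as many zeros as coefficients vanishes. -/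
theorem exponential_polynomial_eq_zero {κ : Type*} [Fintype κ] {w : κ → ℝ}
    (hw : Function.Injective w) (d : κ → ℕ) (P : κ → ℝ[X])
    (hP : ∀ j, ∀ m, d j ≤ m → (P j).coeff m = 0) (Z : Finset ℝ) (hcard : ∑ j, d j ≤ #Z)
    (hZ : ∀ x ∈ Z, ∑ j, (P j).eval x * Real.exp (w j * x) = 0) (j : κ) : P j = 0 := by
  classical
  induction hn : ∑ j, d j generalizing w d P Z j with
  | zero =>
    have hd : d j = 0 := by simpa using (sum_eq_zero_iff.1 hn) j (mem_univ j)
    ext m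
    simpa using hP j m (by omega)
  | succ n ih =>
    obtain ⟨a, -, ha⟩ : ∃ a ∈ univ, d a ≠ 0 := by
      by_contra! h
      rw [sum_eq_zero h] at hn
      omega
    set Q : κ → ℝ[X] := fun j ↦ derivative (P j) + C (w j - w a) * P j with hQ
    have hderiv (x : ℝ) : HasDerivAt (fun x ↦ ∑ j, (P j).eval x * Real.exp ((w j - w a) * x))
        (∑ j, (Q j).eval x * Real.exp ((w j - w a) * x)) x := by
      refine HasDerivAt.fun_sum fun j _ ↦ ?_
      have h := ((P j).hasDerivAt x).mul (((hasDerivAt_id x).const_mul (w j - w a)).exp)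
      refine h.congr_deriv ?_
      simp only [hQ, eval_add, eval_mul, eval_C, id]
      ring
    obtain ⟨Z', hZ'card, hZ'⟩ := exists_card_zeros_deriv hderiv Z (n := n) (hn ▸ hcard)
      fun x hx ↦ by
        have h : ∑ j, (P j).eval x * Real.exp ((w j - w a) * x) =
            Real.exp (-(w a * x)) * ∑ j, (P j).eval x * Real.exp (w j * x) := by
          rw [mul_sum]
          refine sum_congr rfl fun j _ ↦ ?_
          rw [mul_left_comm, ← Real.exp_add]
          ring_nf
        rw [h, hZ x hx, mul_zero]
    have hd' : ∑ j, (Function.update d a (d a - 1)) j = n := by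
      rw [sum_update_of_mem (mem_univ a), ← erase_eq]
      have := add_sum_erase univ d (mem_univ a)
      omega
    have hQ0 (j) : Q j = 0 := by
      refine ih (w := fun j ↦ w j - w a) (fun i j h ↦ hw (by simpa using h))
        (Function.update d a (d a - 1)) Q ?_ Z' (hd' ▸ hZ'card) hZ' j hd'
      intro j m hm
      by_cases hja : j = a
      · subst hja
        rw [Function.update_self] at hm
        simp [hQ, coeff_derivative, hP j (m + 1) (by omega)]
      · rw [Function.update_of_ne hja] at hm
        simp [hQ, coeff_derivative, -map_sub, hP j m hm, hP j (m + 1) (by omega)]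
    have hne (j) (hja : j ≠ a) : P j = 0 := by
      by_contra hPj
      have hc : w j - w a ≠ 0 := sub_ne_zero.2 fun h ↦ hja (hw h)
      have h1 : derivative (P j) = - (C (w j - w a) * P j) := eq_neg_of_add_eq_zero_left (hQ0 j)
      have h2 := degree_derivative_lt hPj
      rw [h1, degree_neg, degree_C_mul hc] at h2
      exact lt_irrefl _ h2
    have hPa : P a = 0 := by
      have h1 : derivative (P a) = 0 := by simpa [hQ] using hQ0 a
      obtain ⟨x, hx⟩ : Z.Nonempty := card_pos.1 (by omega)
      have h2 := hZ x hx
      rw [sum_eq_single a (fun j _ hja ↦ by simp [hne j hja]) (by simp)] at h2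
      rw [eq_C_of_derivative_eq_zero h1] at h2 ⊢
      simpa using h2
    by_cases hja : j = a
    · exact hja ▸ hPa
    · exact hne j hja

open Finset in
theorem Function.Injective.card_mul_pred_le_two_mul_sum {ι : Type*} [Fintype ι] {n : ι → ℕ}
    (hn : Function.Injective n) :
    Fintype.card ι * (Fintype.card ι - 1) ≤ 2 * ∑ k, n k := by
  classical
  have hinj : Function.Injective fun k ↦ (n k : ℤ) := Nat.cast_injective.comp hn
  have h := sum_range_le_sum (s := univ.image fun k ↦ (n k : ℤ)) (c := 0) (by simp)
  rw [card_image_of_injective _ hinj, sum_image fun _ _ _ _ h ↦ hinj h, card_univ] at h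
  have h' : ∑ i ∈ range (Fintype.card ι), i ≤ ∑ k, n k := by
    zify
    simpa using h
  have := sum_range_id_mul_two (Fintype.card ι)
  omega

open Finset in
/-- A generalised Vandermonde determinant is small compared to its value at a dilated point. -/
theorem two_pow_mul_abs_det_pow_le {ι : Type*} [Fintype ι] [DecidableEq ι] (n : ι → ℕ)
    (ζ : ι → ℝ) {ρ : ℝ} (hρ : 0 ≤ ρ) (hζ : ∀ l, |ζ l| ≤ ρ) {V : ℕ}
    (hV : 2 * V ≤ Fintype.card ι * (Fintype.card ι - 1)) :
    2 ^ V * |(Matrix.of fun k l ↦ ζ l ^ n k).det| ≤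
      (Fintype.card ι).factorial * ∏ k, (2 * ρ) ^ n k := by
  by_cases hn : Function.Injective n
  · have hdet : |(Matrix.of fun k l ↦ ζ l ^ n k).det| ≤
        (Fintype.card ι).factorial * ∏ k, ρ ^ n k := by
      rw [← Matrix.det_transpose, Matrix.det_apply]
      refine (abs_sum_le_sum_abs _ _).trans ?_
      refine (sum_le_card_nsmul _ _ (∏ k, ρ ^ n k) fun σ _ ↦ ?_).trans_eq ?_
      · have hsign (y : ℝ) : |Equiv.Perm.sign σ • y| = |y| := by
          rcases Int.units_eq_one_or (Equiv.Perm.sign σ) with h | h <;> simp [h]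
        rw [hsign, abs_prod]
        refine prod_le_prod (fun _ _ ↦ abs_nonneg _) fun k _ ↦ ?_
        rw [Matrix.transpose_apply, Matrix.of_apply, abs_pow]
        exact pow_le_pow_left₀ (abs_nonneg _) (hζ _) _
      · rw [card_univ, Fintype.card_perm, nsmul_eq_mul]
    have hVn : V ≤ ∑ k, n k := by
      have := hn.card_mul_pred_le_two_mul_sum
      omega
    have hpow : (2 : ℝ) ^ V ≤ ∏ k, 2 ^ n k := by
      rw [prod_pow_eq_pow_sum]
      exact pow_le_pow_right₀ one_le_two hVn
    calc _ ≤ (∏ k, 2 ^ n k) * ((Fintype.card ι).factorial * ∏ k, ρ ^ n k) := by gcongr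
      _ = _ := by
        simp only [mul_pow, prod_mul_distrib]
        ring
  · obtain ⟨i, j, hij, hne⟩ : ∃ i j, n i = n j ∧ i ≠ j := by
      simpa [Function.Injective] using hn
    rw [Matrix.det_zero_of_row_eq hne (by ext l; simp [hij]), abs_zero, mul_zero]
    positivity

open Finset in
/-- Schwarz-type bound for an interpolation determinant of polynomials with nonnegative
coefficients. -/
theorem two_pow_mul_abs_det_sum_le {ι : Type*} [Fintype ι] [DecidableEq ι] (N : ℕ)
    (c : ι → ℕ → ℝ) (hc : ∀ k m, 0 ≤ c k m) (e : ι → ℕ → ℕ)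
    (ζ : ι → ℝ) {ρ : ℝ} (hρ : 0 ≤ ρ) (hζ : ∀ l, |ζ l| ≤ ρ) {V : ℕ}
    (hV : 2 * V ≤ Fintype.card ι * (Fintype.card ι - 1)) :
    2 ^ V * |(Matrix.of fun k l ↦ ∑ m ∈ range N, c k m * ζ l ^ e k m).det| ≤
      (Fintype.card ι).factorial * ∏ k, ∑ m ∈ range N, c k m * (2 * ρ) ^ e k m := by
  have hexp : (Matrix.of fun k l ↦ ∑ m ∈ range N, c k m * ζ l ^ e k m).det =
      ∑ r ∈ Fintype.piFinset fun _ : ι ↦ range N,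
        (∏ k, c k (r k)) * (Matrix.of fun k l ↦ ζ l ^ e k (r k)).det := by
    have h := (Matrix.detRowAlternating (R := ℝ) (n := ι)).toMultilinearMap.map_sum_finset
      (fun k m ↦ c k m • fun l ↦ ζ l ^ e k m) (fun _ ↦ range N)
    simp only [MultilinearMap.map_smul_univ, smul_eq_mul] at h
    refine Eq.trans (congrArg Matrix.det ?_) h
    ext k l
    simp
  rw [hexp, prod_univ_sum, mul_sum]
  refine (mul_le_mul_of_nonneg_left (abs_sum_le_sum_abs _ _) (by positivity)).trans ?_
  rw [mul_sum]
  refine sum_le_sum fun r _ ↦ ?_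
  rw [abs_mul, abs_of_nonneg (prod_nonneg fun k _ ↦ hc k (r k)), prod_mul_distrib]
  have h := mul_le_mul_of_nonneg_left
    (two_pow_mul_abs_det_pow_le (fun k ↦ e k (r k)) ζ hρ hζ hV)
    (prod_nonneg fun k (_ : k ∈ univ) ↦ hc k (r k))
  linarith

open Finset in
/-- Schwarz-type bound for an interpolation determinant of functions `x ^ i * exp (w * x)`. -/
theorem two_pow_mul_abs_det_pow_mul_exp_le {ι : Type*} [Fintype ι] [DecidableEq ι]
    (i : ι → ℕ) (w : ι → ℝ) (hw : ∀ k, 0 ≤ w k)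
    (ζ : ι → ℝ) {ρ : ℝ} (hρ : 0 ≤ ρ) (hζ : ∀ l, |ζ l| ≤ ρ) {V : ℕ}
    (hV : 2 * V ≤ Fintype.card ι * (Fintype.card ι - 1)) :
    2 ^ V * |(Matrix.of fun k l ↦ ζ l ^ i k * Real.exp (w k * ζ l)).det| ≤
      (Fintype.card ι).factorial * ∏ k, (2 * ρ) ^ i k * Real.exp (w k * (2 * ρ)) := by
  have hterm (k : ι) (m : ℕ) (x : ℝ) : w k ^ m / m.factorial * x ^ (i k + m) =
      x ^ i k * ((w k * x) ^ m / m.factorial) := by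
    rw [mul_pow, pow_add]
    ring
  have hlim (k : ι) (x : ℝ) : Filter.Tendsto
      (fun N ↦ ∑ m ∈ range N, w k ^ m / m.factorial * x ^ (i k + m)) Filter.atTop
      (nhds (x ^ i k * Real.exp (w k * x))) := by
    simp only [hterm, ← mul_sum]
    rw [Real.exp_eq_exp_ℝ]
    exact ((NormedSpace.expSeries_div_hasSum_exp (w k * x)).tendsto_sum_nat).const_mul _
  have hmat : Filter.Tendsto
      (fun N ↦ Matrix.of fun k l ↦ ∑ m ∈ range N, w k ^ m / m.factorial * ζ l ^ (i k + m))
      Filter.atTop (nhds (Matrix.of fun k l ↦ ζ l ^ i k * Real.exp (w k * ζ l))) :=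
    tendsto_pi_nhds.2 fun k ↦ tendsto_pi_nhds.2 fun l ↦ hlim k (ζ l)
  have hdet := ((continuous_id.matrix_det.tendsto _).comp hmat).abs.const_mul ((2 : ℝ) ^ V)
  have hprod := (tendsto_finsetProd univ fun k _ ↦ hlim k (2 * ρ)).const_mul
    ((Fintype.card ι).factorial : ℝ)
  refine le_of_tendsto_of_tendsto' hdet hprod fun N ↦ ?_
  exact two_pow_mul_abs_det_sum_le N (fun k m ↦ w k ^ m / m.factorial)
    (fun k m ↦ div_nonneg (pow_nonneg (hw k) m) (Nat.cast_nonneg _)) (fun k m ↦ i k + m)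
    ζ hρ hζ hV

open Polynomial in
theorem det_pow_mul_exp_ne_zero {ι : Type*} [Fintype ι] [DecidableEq ι] {T₀ T₁ : ℕ}
    (p : ι ≃ Fin T₀ × Fin T₁) {ζ : ι → ℝ} (hζ : Function.Injective ζ) {w : Fin T₁ → ℝ}
    (hw : Function.Injective w) :
    (Matrix.of fun k l ↦ ζ l ^ ((p k).1 : ℕ) * Real.exp (w (p k).2 * ζ l)).det ≠ 0 := by
  intro h
  obtain ⟨v, hv, hv0⟩ := Matrix.exists_vecMul_eq_zero_iff.2 h
  set P : Fin T₁ → ℝ[X] := fun j ↦ ∑ i : Fin T₀, C (v (p.symm (i, j))) * X ^ (i : ℕ) with hPdef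
  have hcoeff (j : Fin T₁) (m : ℕ) :
      (P j).coeff m = ∑ i : Fin T₀, if m = (i : ℕ) then v (p.symm (i, j)) else 0 := by
    simp [hPdef, coeff_X_pow]
  have hP (j : Fin T₁) : P j = 0 := by
    refine exponential_polynomial_eq_zero hw (fun _ ↦ T₀) P ?_ (Finset.univ.image ζ) ?_ ?_ j
    · intro j m hm
      rw [hcoeff]
      exact Finset.sum_eq_zero fun i _ ↦ if_neg (by have := i.2; omega)
    · rw [Finset.card_image_of_injective _ hζ, Finset.card_univ, Fintype.card_congr p]
      simp [mul_comm]
    · intro x hx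
      obtain ⟨l, -, rfl⟩ := Finset.mem_image.1 hx
      have hl := congrFun hv0 l
      simp only [Matrix.vecMul, dotProduct, Matrix.of_apply, Pi.zero_apply] at hl
      rw [← hl, ← p.symm.sum_comp, Fintype.sum_prod_type_right]
      refine Finset.sum_congr rfl fun j _ ↦ ?_
      simp only [hPdef, eval_finsetSum, eval_mul, eval_C, eval_pow, eval_X, Finset.sum_mul,
        Equiv.apply_symm_apply, mul_assoc]
  refine hv (funext fun k ↦ ?_)
  have h1 := hcoeff (p k).2 (p k).1
  rw [hP, coeff_zero, Finset.sum_eq_single (p k).1] at h1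
  · simpa using h1.symm
  · intro i _ hi
    exact if_neg fun h ↦ hi (Fin.ext h.symm)
  · simp

/-- Liouville's inequality: a nonzero algebraic integer is not too small compared to its
conjugates. -/
theorem NumberField.one_le_abs_mul_pow {K : Type*} [Field K] [NumberField K] (φ : K →+* ℝ) {γ : K}
    (hγ : IsIntegral ℤ γ) (hγ0 : γ ≠ 0) {B : ℝ} (hB : ∀ σ : K →+* ℂ, ‖σ γ‖ ≤ B) :
    1 ≤ |φ γ| * B ^ (Module.finrank ℚ K - 1) := by
  classical
  obtain ⟨m, hm⟩ := IsIntegrallyClosed.isIntegral_iff.1 (Algebra.isIntegral_norm ℚ hγ)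
  have hm0 : m ≠ 0 := by
    rintro rfl
    rw [map_zero] at hm
    exact hγ0 (Algebra.norm_eq_zero_iff.1 hm.symm)
  have hprod := Algebra.norm_eq_prod_embeddings ℚ ℂ γ
  have h1 : (1 : ℝ) ≤ ∏ σ : K →ₐ[ℚ] ℂ, ‖σ γ‖ := by
    rw [← norm_prod, ← hprod, ← hm]
    simpa using Int.one_le_abs hm0 |> (Int.cast_le (R := ℝ)).2
  let τ : K →ₐ[ℚ] ℂ := (Complex.ofRealHom.comp φ).toRatAlgHom
  have hτ : ‖τ γ‖ = |φ γ| := Complex.norm_real (φ γ)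
  rw [← Finset.mul_prod_erase _ _ (Finset.mem_univ τ), hτ] at h1
  refine h1.trans (mul_le_mul_of_nonneg_left ?_ (abs_nonneg _))
  refine (Finset.prod_le_prod (fun σ _ ↦ norm_nonneg _)
    fun (σ : K →ₐ[ℚ] ℂ) _ ↦ hB (σ : K →+* ℂ)).trans_eq ?_
  rw [Finset.prod_const, Finset.card_erase_of_mem (Finset.mem_univ τ), Finset.card_univ,
    AlgHom.card]

theorem exists_mul_add_le_two_pow (a c : ℕ) : ∃ u : ℕ, a * u + c ≤ 2 ^ u := by
  refine ⟨2 * (2 * a + c), ?_⟩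
  have h : 2 * a + c < 2 ^ (2 * a + c) := Nat.lt_two_pow_self
  calc a * (2 * (2 * a + c)) + c ≤ (2 * a + c + 1) * (2 * a + c + 1) := by nlinarith
    _ ≤ 2 ^ (2 * a + c) * 2 ^ (2 * a + c) := Nat.mul_le_mul h h
    _ = _ := by rw [← pow_add, ← two_mul]

theorem factorial_two_pow_le (n : ℕ) : ((2 ^ n).factorial : ℝ) ≤ (2 ^ n) ^ 2 ^ n := by
  exact_mod_cast Nat.factorial_le_pow (2 ^ n)

theorem Fin.val_le_two_pow_three_mul {u : ℕ} (i : Fin ((2 ^ u) ^ 3)) :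
    (i : ℕ) ≤ 2 ^ (3 * u) :=
  i.2.le.trans_eq (by rw [← pow_mul, mul_comm])

theorem Fin.val_mul_val_le_two_pow_three_mul {u : ℕ} (j : Fin (2 ^ u)) (i : Fin ((2 ^ u) ^ 2)) :
    (j : ℕ) * (i : ℕ) ≤ 2 ^ (3 * u) :=
  (Nat.mul_le_mul j.2.le i.2.le).trans_eq (by ring)

theorem norm_natCast_add_mul_le {E : Type*} [NormedField E] [NormedAlgebra ℝ E] {b : E} {u α : ℕ}
    (hb : 1 + ‖b‖ ≤ 2 ^ α) (l : Fin ((2 ^ u) ^ 2) × Fin ((2 ^ u) ^ 2)) :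
    ‖(l.1 : E) + l.2 * b‖ ≤ 2 ^ (2 * u + α) := by
  have hl (i : Fin ((2 ^ u) ^ 2)) : ((i : ℕ) : ℝ) ≤ (2 ^ u) ^ 2 := by
    exact_mod_cast i.2.le
  have hE (i : ℕ) : ‖(i : E)‖ = i := by
    rw [← map_natCast (algebraMap ℝ E), norm_algebraMap', Real.norm_natCast]
  calc ‖(l.1 : E) + l.2 * b‖ ≤ ‖(l.1 : E)‖ + ‖(l.2 : E)‖ * ‖b‖ := by
        rw [← norm_mul]
        exact norm_add_le _ _
    _ ≤ (2 ^ u) ^ 2 + (2 ^ u) ^ 2 * ‖b‖ := by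
        rw [hE, hE]
        gcongr <;> exact hl _
    _ = (2 ^ u) ^ 2 * (1 + ‖b‖) := by ring
    _ ≤ (2 ^ u) ^ 2 * 2 ^ α := by gcongr
    _ = _ := by ring

section

variable {u : ℕ} (p : Fin ((2 ^ u) ^ 2) × Fin ((2 ^ u) ^ 2) ≃ Fin ((2 ^ u) ^ 3) × Fin (2 ^ u))

theorem two_pow_mul_abs_det_exp_log_two_le {β : ℝ} {α : ℕ} (hβ : 1 + |β| ≤ 2 ^ α) {V : ℕ}
    (hV : 2 * V ≤ 2 ^ (4 * u) * (2 ^ (4 * u) - 1)) :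
    2 ^ V * |(Matrix.of fun k l : Fin ((2 ^ u) ^ 2) × Fin ((2 ^ u) ^ 2) ↦
        ((l.1 : ℝ) + l.2 * β) ^ ((p k).1 : ℕ) *
          Real.exp ((p k).2 * Real.log 2 * (l.1 + l.2 * β))).det| ≤
      (2 ^ (4 * u + (2 * u + α + 1) * 2 ^ (3 * u) + 2 * 2 ^ α * 2 ^ (3 * u))) ^ 2 ^ (4 * u) := by
  have hcard : Fintype.card (Fin ((2 ^ u) ^ 2) × Fin ((2 ^ u) ^ 2)) = 2 ^ (4 * u) := by
    simp only [Fintype.card_prod, Fintype.card_fin]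
    ring
  refine (two_pow_mul_abs_det_pow_mul_exp_le (fun k ↦ ((p k).1 : ℕ))
    (fun k ↦ (p k).2 * Real.log 2) (fun k ↦ by positivity)
    (fun l ↦ (l.1 : ℝ) + l.2 * β) (ρ := 2 ^ (2 * u + α)) (by positivity)
    (fun l ↦ norm_natCast_add_mul_le (b := β) hβ l) (hcard ▸ hV)).trans ?_
  have hfactor (k) : ((2 : ℝ) * 2 ^ (2 * u + α)) ^ ((p k).1 : ℕ) *
      Real.exp ((p k).2 * Real.log 2 * (2 * 2 ^ (2 * u + α))) ≤
      2 ^ ((2 * u + α + 1) * 2 ^ (3 * u) + 2 * 2 ^ α * 2 ^ (3 * u)) := by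
    have h1 : Real.exp ((p k).2 * Real.log 2 * (2 * 2 ^ (2 * u + α))) =
        2 ^ (((p k).2 : ℕ) * (2 * 2 ^ (2 * u + α))) := by
      rw [← Real.exp_log (x := 2 ^ (((p k).2 : ℕ) * (2 * 2 ^ (2 * u + α)))) (by positivity),
        Real.log_pow]
      push_cast
      ring_nf
    have h2 : ((p k).1 : ℕ) ≤ 2 ^ (3 * u) := Fin.val_le_two_pow_three_mul _
    have h3 : ((p k).2 : ℕ) * (2 * 2 ^ (2 * u + α)) ≤ 2 * 2 ^ α * 2 ^ (3 * u) :=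
      calc ((p k).2 : ℕ) * (2 * 2 ^ (2 * u + α)) ≤ 2 ^ u * (2 * 2 ^ (2 * u + α)) :=
            Nat.mul_le_mul_right _ (p k).2.2.le
        _ = _ := by ring
    rw [h1, ← pow_succ', ← pow_mul, ← pow_add]
    refine pow_le_pow_right₀ one_le_two (Nat.add_le_add (Nat.mul_le_mul_left _ h2) h3)
  calc _ ≤ ((2 : ℝ) ^ (4 * u)) ^ 2 ^ (4 * u) *
        (2 ^ ((2 * u + α + 1) * 2 ^ (3 * u) + 2 * 2 ^ α * 2 ^ (3 * u))) ^ 2 ^ (4 * u) := by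
        rw [hcard]
        refine mul_le_mul (factorial_two_pow_le _) ?_ (Finset.prod_nonneg fun k _ ↦ by positivity)
          (by positivity)
        refine (Finset.prod_le_prod (fun k _ ↦ by positivity) fun k _ ↦ hfactor k).trans_eq ?_
        rw [Finset.prod_const, Finset.card_univ, hcard]
    _ = _ := by rw [← mul_pow, ← pow_add, ← add_assoc]

/-- The arithmetic interpolation matrix, with denominators cleared by `D`. -/
def interpolationMatrix {F : Type*} [Field F] (D : ℤ) (b r : F) :
    Matrix (Fin ((2 ^ u) ^ 2) × Fin ((2 ^ u) ^ 2)) (Fin ((2 ^ u) ^ 2) × Fin ((2 ^ u) ^ 2)) F :=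
  Matrix.of fun k l ↦ (D : F) ^ (2 * 2 ^ (3 * u)) *
    (((l.1 : F) + l.2 * b) ^ ((p k).1 : ℕ) *
      (2 ^ (((p k).2 : ℕ) * (l.1 : ℕ)) * r ^ (((p k).2 : ℕ) * (l.2 : ℕ))))

theorem map_det_interpolationMatrix {F G : Type*} [Field F] [Field G] (σ : F →+* G) (D : ℤ)
    (b r : F) :
    σ (interpolationMatrix p D b r).det = (interpolationMatrix p D (σ b) (σ r)).det := by
  rw [RingHom.map_det]
  congr 1
  ext k l
  simp only [interpolationMatrix, RingHom.mapMatrix_apply, Matrix.map_apply, Matrix.of_apply,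
    map_mul, map_pow, map_add, map_natCast, map_intCast, map_ofNat]

theorem isIntegral_det_interpolationMatrix {F : Type*} [Field F] {D : ℤ} {b r : F}
    (hb : IsIntegral ℤ (D * b)) (hr : IsIntegral ℤ (D * r)) :
    IsIntegral ℤ (interpolationMatrix p D b r).det := by
  refine IsIntegral.det fun k l ↦ ?_
  have hnat (n : ℕ) : IsIntegral ℤ (n : F) := by
    simpa using isIntegral_algebraMap (R := ℤ) (A := F) (x := n)
  have hD : IsIntegral ℤ (D : F) := isIntegral_algebraMap (x := D)
  have h1 : ((p k).1 : ℕ) ≤ 2 ^ (3 * u) := Fin.val_le_two_pow_three_mul _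
  have h2 : ((p k).2 : ℕ) * (l.2 : ℕ) ≤ 2 ^ (3 * u) :=
      Fin.val_mul_val_le_two_pow_three_mul _ _
  obtain ⟨e, he⟩ : ∃ e, 2 * 2 ^ (3 * u) = ((p k).1 : ℕ) + ((p k).2 : ℕ) * (l.2 : ℕ) + e :=
    Nat.exists_eq_add_of_le (by omega)
  have h : interpolationMatrix p D b r k l = (D * (l.1 : F) + l.2 * (D * b)) ^ ((p k).1 : ℕ) *
      ((2 : ℕ) ^ (((p k).2 : ℕ) * (l.1 : ℕ)) * (D * r) ^ (((p k).2 : ℕ) * (l.2 : ℕ))) * D ^ e := by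
    rw [interpolationMatrix, Matrix.of_apply, he,
      show (D * (l.1 : F) + l.2 * (D * b)) = D * ((l.1 : F) + l.2 * b) by ring,
      mul_pow]
    push_cast
    ring
  rw [h]
  exact (((((hD.mul (hnat _)).add ((hnat _).mul hb)).pow _).mul
    (((hnat 2).pow _).mul (hr.pow _))).mul (hD.pow _))

theorem norm_det_interpolationMatrix_le {D : ℤ} {b r : ℂ} {α : ℕ} (hα : 1 ≤ α)
    (hD : |(D : ℝ)| ≤ 2 ^ α) (hb : 1 + ‖b‖ ≤ 2 ^ α) (hr : ‖r‖ ≤ 2 ^ α) :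
    ‖(interpolationMatrix p D b r).det‖ ≤
      (2 ^ (4 * u + (4 * α + (2 * u + α)) * 2 ^ (3 * u))) ^ 2 ^ (4 * u) := by
  have hcard : Fintype.card (Fin ((2 ^ u) ^ 2) × Fin ((2 ^ u) ^ 2)) = 2 ^ (4 * u) := by
    simp only [Fintype.card_prod, Fintype.card_fin]
    ring
  have hentry (k l) : ‖interpolationMatrix p D b r k l‖ ≤
      2 ^ ((4 * α + (2 * u + α)) * 2 ^ (3 * u)) := by
    have h1 : ((p k).1 : ℕ) ≤ 2 ^ (3 * u) := Fin.val_le_two_pow_three_mul _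
    have h2 (i : Fin ((2 ^ u) ^ 2)) : ((p k).2 : ℕ) * (i : ℕ) ≤ 2 ^ (3 * u) :=
      Fin.val_mul_val_le_two_pow_three_mul _ _
    have hpow {x y : ℝ} (hx : 0 ≤ x) (hxy : x ≤ y) (hy : 1 ≤ y) {m n : ℕ} (hmn : m ≤ n) :
        x ^ m ≤ y ^ n := (pow_le_pow_left₀ hx hxy m).trans (pow_le_pow_right₀ hy hmn)
    have hone (m : ℕ) : (1 : ℝ) ≤ 2 ^ m := one_le_pow₀ one_le_two
    have hnormD : ‖(D : ℂ)‖ ≤ 2 ^ α := by simpa using hD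
    have htwo : ‖(2 : ℂ)‖ ≤ 2 ^ α := by
      simpa using pow_le_pow_right₀ (one_le_two (α := ℝ)) hα
    rw [interpolationMatrix, Matrix.of_apply, norm_mul, norm_mul, norm_mul, norm_pow, norm_pow,
      norm_pow, norm_pow]
    calc _ ≤ ((2 : ℝ) ^ α) ^ (2 * 2 ^ (3 * u)) * ((2 ^ (2 * u + α)) ^ 2 ^ (3 * u) *
          ((2 ^ α) ^ 2 ^ (3 * u) * (2 ^ α) ^ 2 ^ (3 * u))) := by
          gcongr ?_ * (?_ * (?_ * ?_))
          · exact hpow (norm_nonneg _) hnormD (hone _) le_rfl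
          · exact hpow (norm_nonneg _) (norm_natCast_add_mul_le hb l) (hone _) h1
          · exact hpow (norm_nonneg _) htwo (hone _) (h2 _)
          · exact hpow (norm_nonneg _) hr (hone _) (h2 _)
      _ = _ := by
          simp only [← pow_mul, ← pow_add]
          ring_nf
  have h := Matrix.det_le (abv := NormedField.toAbsoluteValue ℂ)
    (A := interpolationMatrix p D b r) hentry
  rw [hcard, nsmul_eq_mul] at h
  refine (h.trans (mul_le_mul_of_nonneg_right (factorial_two_pow_le _) (by positivity))).trans_eq ?_
  rw [← mul_pow, ← pow_add]

end

/-- The Gelfond–Schneider theorem for base `2`, a real algebraic exponent and a rational value. -/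
theorem two_rpow_ne_ratCast {K : Type*} [Field K] [NumberField K] (φ : K →+* ℝ) {b : K}
    (hb : Irrational (φ b)) (r : ℚ) : (2 : ℝ) ^ φ b ≠ r := by
  intro hr
  obtain ⟨y, hy0, hy⟩ :=
    ((IsFractionRing.isAlgebraic_iff ℤ ℚ K).2
      (Algebra.IsAlgebraic.isAlgebraic b)).exists_integral_multiple
  set D : ℤ := y * r.den with hD
  have hD0 : D ≠ 0 := mul_ne_zero hy0 (by exact_mod_cast r.den_nz)
  have hDb : IsIntegral ℤ (D * b) := by
    have h : (D : K) * b = (r.den : ℤ) • (y • b) := by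
      simp only [hD, zsmul_eq_mul]
      push_cast
      ring
    exact h ▸ hy.smul _
  have hDr : IsIntegral ℤ ((D : K) * r) := by
    have h : (D : K) * r = ((y * r.num : ℤ) : K) := by
      have h1 : (r : K) * r.den = r.num := by exact_mod_cast r.mul_den_eq_num
      rw [hD]
      push_cast
      rw [← h1]
      ring
    exact h ▸ isIntegral_algebraMap (x := y * r.num)
  obtain ⟨α, hα⟩ := pow_unbounded_of_one_lt
    (|(D : ℝ)| + (1 + ∑ σ : K →+* ℂ, ‖σ b‖) + |(r : ℝ)| + 1) (one_lt_two (α := ℝ))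
  have hsum (σ : K →+* ℂ) : ‖σ b‖ ≤ ∑ σ : K →+* ℂ, ‖σ b‖ :=
    Finset.single_le_sum (f := fun σ : K →+* ℂ ↦ ‖σ b‖) (fun _ _ ↦ norm_nonneg _)
      (Finset.mem_univ σ)
  have hsum0 : 0 ≤ ∑ σ : K →+* ℂ, ‖σ b‖ := Finset.sum_nonneg fun _ _ ↦ norm_nonneg _
  have hDα : |(D : ℝ)| ≤ 2 ^ α := by linarith [abs_nonneg (r : ℝ)]
  have hrα : |(r : ℝ)| ≤ 2 ^ α := by linarith [abs_nonneg (D : ℝ)]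
  have hbα (σ : K →+* ℂ) : 1 + ‖σ b‖ ≤ 2 ^ α := by
    linarith [abs_nonneg (D : ℝ), abs_nonneg (r : ℝ), hsum σ]
  have hφα : 1 + |φ b| ≤ 2 ^ α := by simpa using hbα (Complex.ofRealHom.comp φ)
  have hα1 : 1 ≤ α := by
    by_contra! h
    obtain rfl : α = 0 := by omega
    linarith [abs_nonneg (D : ℝ), abs_nonneg (r : ℝ)]
  set k := Module.finrank ℚ K - 1
  obtain ⟨u, hu⟩ := exists_mul_add_le_two_pow (2 * (6 + 6 * k))
    (2 * (3 * α + 1 + 2 * 2 ^ α + 5 * k * α) + 3)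
  obtain ⟨p⟩ : Nonempty
      (Fin ((2 ^ u) ^ 2) × Fin ((2 ^ u) ^ 2) ≃ Fin ((2 ^ u) ^ 3) × Fin (2 ^ u)) :=
    Fintype.card_eq.1 (by simp only [Fintype.card_prod, Fintype.card_fin]; ring)
  set W := 2 ^ (3 * u) with hW
  set C := 2 * α * W + (4 * u + (2 * u + α + 1) * W + 2 * 2 ^ α * W) +
    k * (4 * u + (4 * α + (2 * u + α)) * W) with hC
  have hW1 : 1 ≤ W := Nat.one_le_two_pow
  have hCL : 2 * (C + 1) ≤ 2 ^ (4 * u) - 1 := by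
    have h1 : 2 ^ (4 * u) = 2 ^ u * W := by rw [hW]; ring
    have h2 : 2 * C + 3 ≤ 2 ^ u * W := by
      refine le_trans ?_ (Nat.mul_le_mul_right W hu)
      have h3 : 4 * u * 1 ≤ 4 * u * W := Nat.mul_le_mul_left _ hW1
      have h4 : k * (4 * u * 1) ≤ k * (4 * u * W) := Nat.mul_le_mul_left _ h3
      rw [hC]
      nlinarith
    omega
  have hV : 2 * ((C + 1) * 2 ^ (4 * u)) ≤ 2 ^ (4 * u) * (2 ^ (4 * u) - 1) := by
    rw [← mul_assoc, mul_comm]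
    exact Nat.mul_le_mul_left _ hCL
  have hupper := two_pow_mul_abs_det_exp_log_two_le p hφα hV
  set Δ := (Matrix.of fun k l : Fin ((2 ^ u) ^ 2) × Fin ((2 ^ u) ^ 2) ↦
        ((l.1 : ℝ) + l.2 * φ b) ^ ((p k).1 : ℕ) *
          Real.exp ((p k).2 * Real.log 2 * (l.1 + l.2 * φ b))).det with hΔ
  have hΔ0 : Δ ≠ 0 := by
    refine det_pow_mul_exp_ne_zero p (ζ := fun l ↦ (l.1 : ℝ) + l.2 * φ b)
      (w := fun j ↦ (j : ℕ) * Real.log 2) ?_ ?_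
    · intro l m h
      have h2 : l.2 = m.2 := by
        by_contra hne
        have hne' : ((l.2 : ℕ) : ℤ) - (m.2 : ℕ) ≠ 0 :=
          sub_ne_zero.2 fun h ↦ hne (Fin.ext (by exact_mod_cast h))
        refine ((hb.intCast_mul hne').add_intCast ((l.1 : ℕ) - (m.1 : ℕ))).ne_zero ?_
        push_cast
        linear_combination h
      have h1 : l.1 = m.1 := by
        have : ((l.1 : ℕ) : ℝ) = (m.1 : ℕ) := by
          simpa [h2] using h
        exact Fin.ext (by exact_mod_cast this)
      exact Prod.ext h1 h2
    · intro i j h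
      have : ((i : ℕ) : ℝ) = (j : ℕ) := by
        simpa [(Real.log_pos one_lt_two).ne'] using h
      exact Fin.ext (by exact_mod_cast this)
  have hdet : φ (interpolationMatrix p D b (r : K)).det =
      ((D : ℝ) ^ (2 * W)) ^ 2 ^ (4 * u) * Δ := by
    have hcard : Fintype.card (Fin ((2 ^ u) ^ 2) × Fin ((2 ^ u) ^ 2)) = 2 ^ (4 * u) := by
      simp only [Fintype.card_prod, Fintype.card_fin]
      ring
    rw [map_det_interpolationMatrix, map_ratCast, hΔ, ← hcard, ← Matrix.det_smul]
    congr 1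
    ext i l
    rw [interpolationMatrix, Matrix.smul_apply, Matrix.of_apply, Matrix.of_apply, smul_eq_mul,
      ← hr, ← Real.rpow_mul_natCast two_pos.le, ← Real.rpow_natCast 2,
      ← Real.rpow_add two_pos, Real.rpow_def_of_pos two_pos, hW]
    push_cast
    ring_nf
  have hne : (interpolationMatrix p D b (r : K)).det ≠ 0 := by
    intro h
    rw [h, map_zero] at hdet
    exact mul_ne_zero (pow_ne_zero _ (pow_ne_zero _ (by exact_mod_cast hD0))) hΔ0 hdet.symm
  have hlower := NumberField.one_le_abs_mul_pow φ
    (isIntegral_det_interpolationMatrix p hDb hDr) hne fun σ ↦ by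
      rw [map_det_interpolationMatrix, map_ratCast]
      exact norm_det_interpolationMatrix_le p hα1 hDα (hbα σ) (by simpa using hrα)
  rw [hdet, abs_mul, abs_pow, abs_pow] at hlower
  have hfinal : (2 : ℝ) ^ ((C + 1) * 2 ^ (4 * u)) ≤ 2 ^ (C * 2 ^ (4 * u)) :=
    calc (2 : ℝ) ^ ((C + 1) * 2 ^ (4 * u))
        ≤ 2 ^ ((C + 1) * 2 ^ (4 * u)) * ((|(D : ℝ)| ^ (2 * W)) ^ 2 ^ (4 * u) * |Δ| *
          ((2 ^ (4 * u + (4 * α + (2 * u + α)) * W)) ^ 2 ^ (4 * u)) ^ k) :=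
          le_mul_of_one_le_right (by positivity) hlower
      _ = (|(D : ℝ)| ^ (2 * W)) ^ 2 ^ (4 * u) * (2 ^ ((C + 1) * 2 ^ (4 * u)) * |Δ|) *
          ((2 ^ (4 * u + (4 * α + (2 * u + α)) * W)) ^ 2 ^ (4 * u)) ^ k := by ring
      _ ≤ ((2 ^ α) ^ (2 * W)) ^ 2 ^ (4 * u) *
          (2 ^ (4 * u + (2 * u + α + 1) * W + 2 * 2 ^ α * W)) ^ 2 ^ (4 * u) *
          ((2 ^ (4 * u + (4 * α + (2 * u + α)) * W)) ^ 2 ^ (4 * u)) ^ k := by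
          gcongr
      _ = 2 ^ (C * 2 ^ (4 * u)) := by
          simp only [← pow_mul, ← pow_add]
          congr 1
          rw [hC]
          ring
  have hlt : (C + 1) * 2 ^ (4 * u) ≤ C * 2 ^ (4 * u) :=
    (pow_le_pow_iff_right₀ one_lt_two).1 hfinal
  have : 0 < 2 ^ (4 * u) := by positivity
  nlinarith

/-- If a power of `2` with real algebraic exponent is rational, then the exponent is rational. -/
theorem not_irrational_of_two_rpow_eq_ratCast {β : ℝ} (hβ : IsAlgebraic ℚ β) {r : ℚ}
    (hr : (2 : ℝ) ^ β = r) : ¬ Irrational β := by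
  intro hirr
  have := IntermediateField.adjoin.finiteDimensional hβ.isIntegral
  have : NumberField (IntermediateField.adjoin ℚ {β}) := { }
  exact two_rpow_ne_ratCast (algebraMap (IntermediateField.adjoin ℚ {β}) ℝ)
    (b := IntermediateField.AdjoinSimple.gen ℚ β) hirr r hr

theorem transcendental_logb_two {r : ℚ} (hr : 0 < r) (p : ℕ) [Fact p.Prime] (hp : p ≠ 2)
    (hpr : padicValRat p r ≠ 0) : Transcendental ℚ (Real.logb 2 r) := by
  intro h
  have hr' : (2 : ℝ) ^ Real.logb 2 r = r :=
    Real.rpow_logb two_pos (by norm_num) (by exact_mod_cast hr)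
  obtain ⟨q, hq⟩ := not_not.1 (not_irrational_of_two_rpow_eq_ratCast h hr')
  rw [← hq] at hr'
  have h1 : (2 : ℝ) ^ q.num = (r : ℝ) ^ q.den := by
    rw [← hr', ← Real.rpow_natCast, ← Real.rpow_mul two_pos.le, ← Real.rpow_intCast]
    congr 1
    exact_mod_cast q.mul_den_eq_num.symm
  have h2 : (2 : ℚ) ^ q.num = r ^ q.den :=
    Rat.cast_injective (α := ℝ) (by push_cast; exact h1)
  have h3 := congrArg (padicValRat p) h2
  have h4 : padicValRat p (2 : ℚ) = 0 := by
    have : padicValNat p 2 = 0 := padicValNat_primes hp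
    exact_mod_cast congrArg (Nat.cast (R := ℤ)) this
  rw [padicValRat.zpow, padicValRat.pow, h4, mul_zero] at h3
  exact (mul_ne_zero (by exact_mod_cast q.den_nz) hpr) h3.symm

theorem exists_prime_padicValRat_ne_zero {a c : ℕ} (ha : 0 < a) (hac : a < c)
    (hcop : a.Coprime c) : ∃ p : ℕ, p.Prime ∧ p ≠ 2 ∧
      padicValRat p ((2 : ℚ) ^ (a + c) * a ^ a * c ^ c / (a + c : ℕ) ^ (a + c)) ≠ 0 := by
  have hc : 0 < c := by omega
  have hval (p : ℕ) (hp : p.Prime) (hp2 : p ≠ 2) :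
      padicValRat p ((2 : ℚ) ^ (a + c) * a ^ a * c ^ c / (a + c : ℕ) ^ (a + c)) =
        a * padicValNat p a + c * padicValNat p c - (a + c) * padicValNat p (a + c) := by
    have := Fact.mk hp
    have h2 : padicValRat p (2 : ℚ) = 0 := by
      have : padicValNat p 2 = 0 := padicValNat_primes hp2
      exact_mod_cast congrArg (Nat.cast (R := ℤ)) this
    have ha' : (a : ℚ) ≠ 0 := by positivity
    have hc' : (c : ℚ) ≠ 0 := by positivity
    have hd' : ((a + c : ℕ) : ℚ) ≠ 0 := by positivity
    rw [padicValRat.div (by positivity) (by positivity), padicValRat.mul (by positivity)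
      (by positivity), padicValRat.mul (by positivity) (by positivity)]
    simp only [padicValRat.pow, h2, padicValRat.of_nat]
    push_cast
    ring
  have hpos (p : ℕ) (hp : p.Prime) {n : ℕ} (hn : 0 < n) (h : p ∣ n) :
      (0 : ℤ) < n * padicValNat p n := by
    have := Fact.mk hp
    exact_mod_cast Nat.mul_pos hn (one_le_padicValNat_of_dvd hn.ne' h)
  have hnot (p : ℕ) (hp : p.Prime) (h1 : p ∣ a) (h2 : p ∣ c) : False :=
    hp.one_lt.ne' (Nat.dvd_one.1 (hcop ▸ Nat.dvd_gcd h1 h2))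
  rcases Nat.even_or_odd (a + c) with hd | hd
  · have hp := Nat.minFac_prime (n := c) (by omega)
    have hpc := Nat.minFac_dvd c
    have hpa : ¬ c.minFac ∣ a := fun h ↦ hnot _ hp h hpc
    have hp2 : c.minFac ≠ 2 := by
      intro h
      rw [h] at hpc hpa
      rw [Nat.even_iff] at hd
      omega
    refine ⟨c.minFac, hp, hp2, ?_⟩
    rw [hval _ hp hp2, padicValNat.eq_zero_of_not_dvd hpa,
      padicValNat.eq_zero_of_not_dvd fun h ↦ hpa ((Nat.dvd_add_left hpc).1 h)]
    simpa using (hpos _ hp hc hpc).ne'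
  · have hp := Nat.minFac_prime (n := a + c) (by omega)
    have hpd := Nat.minFac_dvd (a + c)
    have hp2 : (a + c).minFac ≠ 2 := by
      intro h
      rw [h] at hpd
      rw [Nat.odd_iff] at hd
      omega
    refine ⟨(a + c).minFac, hp, hp2, ?_⟩
    rw [hval _ hp hp2,
      padicValNat.eq_zero_of_not_dvd fun h ↦ hnot _ hp h ((Nat.dvd_add_right h).1 hpd),
      padicValNat.eq_zero_of_not_dvd fun h ↦ hnot _ hp ((Nat.dvd_add_left h).1 hpd) h]
    simpa using (hpos _ hp (by omega) hpd).ne'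

theorem natCast_mul_one_sub_binH {a c : ℕ} (ha : 0 < a) (hc : 0 < c) :
    ((a + c : ℕ) : ℝ) * (1 - binH (a / (a + c : ℕ))) =
      Real.logb 2 ((2 : ℝ) ^ (a + c) * a ^ a * c ^ c / (a + c : ℕ) ^ (a + c)) := by
  have ha' : (a : ℝ) ≠ 0 := by positivity
  have hc' : (c : ℝ) ≠ 0 := by positivity
  have hd' : ((a + c : ℕ) : ℝ) ≠ 0 := by positivity
  have h1 : 1 - (a : ℝ) / (a + c : ℕ) = c / (a + c : ℕ) := by
    rw [eq_div_iff hd', sub_mul, div_mul_cancel₀ _ hd']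
    push_cast
    ring
  rw [binH, h1, Real.logb_div ha' hd', Real.logb_div hc' hd',
    Real.logb_div (by positivity) (by positivity), Real.logb_mul (by positivity) (by positivity),
    Real.logb_mul (by positivity) (by positivity), Real.logb_pow, Real.logb_pow, Real.logb_pow,
    Real.logb_pow, Real.logb_self_eq_one one_lt_two]
  field_simp
  push_cast
  ring

theorem bsc_capacity_transcendental (ε : ℚ) (h0 : 0 < ε) (h1 : ε < 1 / 2) :
    Transcendental ℤ (1 - binH (ε : ℝ)) := by
  obtain ⟨a, ha⟩ := Int.eq_ofNat_of_zero_le (Rat.num_nonneg.2 h0.le)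
  have hε : ε = a / ε.den := by
    conv_lhs => rw [← Rat.num_div_den ε, ha]
    simp
  have hden : (0 : ℚ) < ε.den := by exact_mod_cast ε.den_pos
  have ha0 : 0 < a := by
    have := Rat.num_pos.2 h0
    omega
  have hlt : 2 * a < ε.den := by
    rw [hε, div_lt_iff₀ hden] at h1
    have : (2 * a : ℚ) < ε.den := by linarith
    exact_mod_cast this
  have hcop : a.Coprime ε.den := by simpa [ha] using ε.reduced
  obtain ⟨c, hc⟩ := Nat.exists_eq_add_of_le (show a ≤ ε.den by omega)
  rw [hc] at hε hcop hlt
  obtain ⟨p, hp, hp2, hval⟩ := exists_prime_padicValRat_ne_zero ha0 (c := c) (by omega)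
    (by simpa using hcop)
  have := Fact.mk hp
  have htrans := transcendental_logb_two (r := 2 ^ (a + c) * a ^ a * c ^ c / (a + c : ℕ) ^ (a + c))
    (by have : 0 < c := by omega
        positivity) p hp2 hval
  intro h
  refine htrans ?_
  have h2 := (isAlgebraic_natCast (R := ℚ) (A := ℝ) (a + c)).mul
    ((IsFractionRing.isAlgebraic_iff ℤ ℚ ℝ).1 h)
  have hε' : (ε : ℝ) = a / (a + c : ℕ) := by
    rw [hε]
    push_cast
    rfl
  rw [hε', natCast_mul_one_sub_binH ha0 (by omega)] at h2
  push_cast at h2 ⊢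
  exact h2
end
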